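/- Let T be a linear involution on the alphabet A without connection and let S = L(T) be its natural coding. For every subgroup G of finite index of the free group F_A, the set of prime words in S with respect to G is a symmetric basis of G. -/

import Mathlib

open Set

namespace LinInv

/-- A letter of the extended alphabet `A ∪ A⁻¹`, encoded as a pair of a letter
of `A` and a sign. -/
abbrev Letter (A : Type*) := A × Bool

/-- The formal inverse of a letter. -/
def Letter.inv {A : Type*} (c : Letter A) : Letter A := (c.1, !c.2)

/-- The inverse of a word over `A ∪ A⁻¹`. -/
def wordInv {A : Type*} (u : List (Letter A)) : List (Letter A) :=
  (u.map Letter.inv).reverse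

/-- The involution `σ₂` exchanging the two components of `Î = I × {0,1}`. -/
def s2 (z : ℝ × Bool) : ℝ × Bool := (z.1, !z.2)

/-- A linear involution on the alphabet `A`: the open interval `I = ]lo,hi[`,
for each `c ∈ A ∪ A⁻¹` an open subinterval `I_c = ]endLo c, endHi c[ × {comp c}`
of one of the two components of `Î = I × {0,1}`, the finite set `Sig` of division
points, and the first involution `σ₁`, subject to the defining conditions. -/
structure LinearInvolution (A : Type*) [Fintype A] where
  lo : ℝ
  hi : ℝ
  lo_lt_hi : lo < hi
  endLo : Letter A → ℝ
  endHi : Letter A → ℝ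
  end_lt : ∀ c, endLo c < endHi c
  comp : Letter A → Bool
  sub_lo : ∀ c, lo ≤ endLo c
  sub_hi : ∀ c, endHi c ≤ hi
  /-- the length data satisfy `λ_a = λ_{a⁻¹}` -/
  len_inv : ∀ c, endHi c - endLo c = endHi (Letter.inv c) - endLo (Letter.inv c)
  /-- the set of division points -/
  Sig : Set (ℝ × Bool)
  Sig_sub : Sig ⊆ Ioo lo hi ×ˢ (univ : Set Bool)
  /-- there are `2k-2` division points -/
  Sig_card : Sig.ncard = 2 * Fintype.card A - 2
  /-- the intervals `I_c` are pairwise disjoint -/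
  disj : ∀ c d : Letter A, c ≠ d →
    Disjoint (Ioo (endLo c) (endHi c) ×ˢ ({comp c} : Set Bool))
      (Ioo (endLo d) (endHi d) ×ˢ ({comp d} : Set Bool))
  Sig_disj : ∀ c : Letter A,
    Disjoint Sig (Ioo (endLo c) (endHi c) ×ˢ ({comp c} : Set Bool))
  /-- the intervals `I_c` partition `Î` minus the division points -/
  cover : Ioo lo hi ×ˢ (univ : Set Bool) =
    (⋃ c : Letter A, Ioo (endLo c) (endHi c) ×ˢ ({comp c} : Set Bool)) ∪ Sig
  /-- the first involution `σ₁` (as a total map; only its values on `Î ∖ Σ` matter) -/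
  s1 : ℝ × Bool → ℝ × Bool
  s1_invol : ∀ z ∈ (Ioo lo hi ×ˢ (univ : Set Bool)) \ Sig, s1 (s1 z) = z
  /-- on each `I_c`, `σ₁` is either a translation or a symmetry -/
  s1_iso : ∀ c : Letter A,
    (∃ α : ℝ, ∀ z ∈ Ioo (endLo c) (endHi c) ×ˢ ({comp c} : Set Bool),
        s1 z = (z.1 + α, comp (Letter.inv c))) ∨
    (∃ α : ℝ, ∀ z ∈ Ioo (endLo c) (endHi c) ×ˢ ({comp c} : Set Bool),
        s1 z = (-z.1 + α, comp (Letter.inv c)))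
  /-- `σ₁` maps `I_c` onto `I_{c⁻¹}` -/
  s1_image : ∀ c : Letter A,
    s1 '' (Ioo (endLo c) (endHi c) ×ˢ ({comp c} : Set Bool)) =
      Ioo (endLo (Letter.inv c)) (endHi (Letter.inv c)) ×ˢ
        ({comp (Letter.inv c)} : Set Bool)

namespace LinearInvolution

variable {A : Type*} [Fintype A] (L : LinearInvolution A)

/-- The domain `Î = I × {0,1}`. -/
def Ihat : Set (ℝ × Bool) := Ioo L.lo L.hi ×ˢ (univ : Set Bool)

/-- The interval `I_c` associated with the letter `c ∈ A ∪ A⁻¹`. -/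
def Ia (c : Letter A) : Set (ℝ × Bool) :=
  Ioo (L.endLo c) (L.endHi c) ×ˢ ({L.comp c} : Set Bool)

/-- The linear involution `T = σ₂ ∘ σ₁`. -/
def T (z : ℝ × Bool) : ℝ × Bool := s2 (L.s1 z)

/-- `O = ⋃_{n ≥ 0} T⁻ⁿ(Σ)`, the negative orbit of the singular points. -/
def O : Set (ℝ × Bool) := ⋃ n : ℕ, (L.T)^[n] ⁻¹' L.Sig

/-- `Ô = O ∪ σ₂(O)`. -/
def Ohat : Set (ℝ × Bool) := L.O ∪ s2 '' L.O

/-- `T` has a connection if some singularity `x` of `T⁻¹` reaches a singularity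
`y` of `T` in `n ≥ 0` steps. -/
def HasConnection : Prop := ∃ x ∈ s2 '' L.Sig, ∃ n : ℕ, (L.T)^[n] x ∈ L.Sig

/-- `T` is nonorientable if some `I_c` and `I_{c⁻¹}` lie in the same component. -/
def Nonorientable : Prop := ∃ c : Letter A, L.comp c = L.comp (Letter.inv c)

/-- `T` is orientable if it is not nonorientable. -/
def Orientable : Prop := ¬ L.Nonorientable

/-- `u` occurs in the natural coding of the orbit of `z` at position `m`. -/
def IsCodingFrom (z : ℝ × Bool) (m : ℕ) (u : List (Letter A)) : Prop :=
  ∀ i : Fin u.length, (L.T)^[m + i.1] z ∈ L.Ia (u.get i)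

/-- The natural coding `L(T)`: the set of factors of the infinite natural
codings `Σ_T(z)` for `z ∈ Î ∖ Ô`. -/
def lang : Set (List (Letter A)) :=
  {u | ∃ z ∈ L.Ihat \ L.Ohat, ∃ m : ℕ, L.IsCodingFrom z m u}

/-- The interval `I_w = I_{a₀} ∩ T⁻¹(I_{a₁}) ∩ ⋯ ∩ T^{-m+1}(I_{a_{m-1}})`
associated with a word `w = a₀a₁⋯a_{m-1}`; by convention `I_ε = Î`. -/
def Iw (u : List (Letter A)) : Set (ℝ × Bool) :=
  L.Ihat ∩ ⋂ i : Fin u.length, (L.T)^[i.1] ⁻¹' L.Ia (u.get i)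

/-- The return time `ρ_X(x) = inf {n ≥ 1 ∣ Tⁿ(x) ∈ X}`, with value `∞` if the
orbit of `x` never returns to `X`. -/
noncomputable def retTime (X : Set (ℝ × Bool)) (x : ℝ × Bool) : ℕ∞ :=
  sInf {n : ℕ∞ | ∃ m : ℕ, n = (m : ℕ∞) ∧ 1 ≤ m ∧ (L.T)^[m] x ∈ X}

/-- A word is even if it has an even number of odd letters (a letter `a` is odd
when `I_a` and `I_{a⁻¹}` lie in the same component). -/
def EvenWord (u : List (Letter A)) : Prop :=
  Even (u.countP fun c => L.comp (c.1, true) == L.comp (c.1, false))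

/-- The morphism `F_A → ℤ/2ℤ` sending each odd letter to `1` and each even
letter to `0`. -/
noncomputable def evenHom : FreeGroup A →* Multiplicative (ZMod 2) :=
  FreeGroup.lift fun a =>
    Multiplicative.ofAdd (if L.comp (a, true) = L.comp (a, false) then (1 : ZMod 2) else 0)

/-- The even group: the subgroup of `F_A` formed by the even elements. -/
noncomputable def evenGroup : Subgroup (FreeGroup A) := (L.evenHom).ker

/-- The admissibility condition at an endpoint `x` of an interval `J`:
either `x = Tⁿ(z)` for a singularity `z` of `T⁻¹` with `T^k(z) ∉ J` for
`0 ≤ k ≤ n`, or `Tⁿ(x) = z` for a singularity `z` of `T` with `T^k(x) ∉ J`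
for `0 ≤ k ≤ n`. -/
def AdmissibleEndpoint (J : Set (ℝ × Bool)) (x : ℝ × Bool) : Prop :=
  (∃ z ∈ s2 '' L.Sig, ∃ n : ℕ, (L.T)^[n] z = x ∧ ∀ k ≤ n, (L.T)^[k] z ∉ J) ∨
  (∃ z ∈ L.Sig, ∃ n : ℕ, (L.T)^[n] x = z ∧ ∀ k ≤ n, (L.T)^[k] x ∉ J)

/-- The open interval `]u,v[ × {δ}` is admissible with respect to `T`. -/
def AdmissibleInterval (u v : ℝ) (δ : Bool) : Prop :=
  u < v ∧ L.AdmissibleEndpoint (Ioo u v ×ˢ ({δ} : Set Bool)) (u, δ) ∧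
    L.AdmissibleEndpoint (Ioo u v ×ˢ ({δ} : Set Bool)) (v, δ)

end LinearInvolution

/-- A set of words is factorial if it contains the factors of its elements. -/
def FactorialSet {α : Type*} (S : Set (List α)) : Prop :=
  ∀ u ∈ S, ∀ v : List α, v <:+: u → v ∈ S

/-- A word over `A ∪ A⁻¹` is reduced if it has no factor `c c⁻¹`. -/
def Reduced {A : Type*} (u : List (Letter A)) : Prop :=
  u.Chain' fun c d => d ≠ Letter.inv c

/-- A laminary set on `A`: a symmetric factorial set of reduced words on
`A ∪ A⁻¹`. -/
def Laminary {A : Type*} (S : Set (List (Letter A))) : Prop :=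
  FactorialSet S ∧ (∀ u ∈ S, wordInv u ∈ S) ∧ ∀ u ∈ S, Reduced u

/-- A laminary set is orientable if it splits as `S₊ ∪ S₋` with `S₊, S₋`
factorial, `S₊ ∩ S₋ = {ε}`, and `x ∈ S₋ ↔ x⁻¹ ∈ S₊`. -/
def OrientableSet {A : Type*} (S : Set (List (Letter A))) : Prop :=
  ∃ Sp Sm : Set (List (Letter A)), FactorialSet Sp ∧ FactorialSet Sm ∧
    S = Sp ∪ Sm ∧ Sp ∩ Sm = {([] : List (Letter A))} ∧
    ∀ x ∈ S, (x ∈ Sm ↔ wordInv x ∈ Sp)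

/-- A set of words is uniformly recurrent if it is right extendable and every
`u ∈ S` occurs in every long enough word of `S`. -/
def UniformlyRecurrent {α : Type*} (S : Set (List α)) : Prop :=
  (∀ u ∈ S, ∃ c : α, u ++ [c] ∈ S) ∧
  ∀ u ∈ S, ∃ n : ℕ, 1 ≤ n ∧ ∀ w ∈ S, w.length = n → u <:+: w

/-- A set of words over `A ∪ A⁻¹` is uniformly semi-recurrent if it is right
extendable and for every `u ∈ S`, every long enough word of `S` contains `u` or
`u⁻¹` as a factor. -/
def UniformlySemiRecurrent {A : Type*} (S : Set (List (Letter A))) : Prop :=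
  (∀ u ∈ S, ∃ c : Letter A, u ++ [c] ∈ S) ∧
  ∀ u ∈ S, ∃ n : ℕ, 1 ≤ n ∧ ∀ w ∈ S, w.length = n → (u <:+: w ∨ wordInv u <:+: w)

/-- A laminary set is semi-recurrent if for all `u, w ∈ S` there is `v ∈ S`
with `uvw ∈ S` or `uvw⁻¹ ∈ S`. -/
def SemiRecurrent {A : Type*} (S : Set (List (Letter A))) : Prop :=
  ∀ u ∈ S, ∀ w ∈ S, ∃ v ∈ S, u ++ v ++ w ∈ S ∨ u ++ v ++ wordInv w ∈ S

/-- A complete return word to `X ⊆ S`: a word of `S` with a proper prefix in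
`X` and a proper suffix in `X`. -/
def CompleteReturnWord {α : Type*} (S X : Set (List α)) (u : List α) : Prop :=
  u ∈ S ∧ (∃ p ∈ X, p <+: u ∧ p ≠ u) ∧ (∃ s ∈ X, s <:+ u ∧ s ≠ u)

/-- A complete first return word to `X`: a complete return word to `X` with no
internal factor in `X`. -/
def CompleteFirstReturnWord {α : Type*} (S X : Set (List α)) (u : List α) : Prop :=
  CompleteReturnWord S X u ∧
    ¬ ∃ p v s : List α, u = p ++ v ++ s ∧ v ∈ X ∧ p ≠ [] ∧ s ≠ []

/-- `CR S w`: the set of complete first return words to `{w, w⁻¹}` in `S`. -/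
def CR {A : Type*} (S : Set (List (Letter A))) (w : List (Letter A)) :
    Set (List (Letter A)) :=
  {u | CompleteFirstReturnWord S {w, wordInv w} u}

open Classical in
/-- The operation `N` on complete return words to `{w, w⁻¹}`: erase the prefix
`w` if present, and erase the suffix `w⁻¹` if present. -/
noncomputable def NN {A : Type*} (w u : List (Letter A)) : List (Letter A) :=
  let u' := if w <+: u then u.drop w.length else u
  if wordInv w <:+ u' then u'.take (u'.length - w.length) else u'

/-- `MR S w`: the set of mixed first return words to `w` in `S`. -/
noncomputable def MR {A : Type*} (S : Set (List (Letter A))) (w : List (Letter A)) :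
    Set (List (Letter A)) :=
  NN w '' CR S w

/-- `RightReturn S w`: the set of first right return words to `w` in `S`,
i.e. the words `u` such that `wu` is a complete first return word to `{w}`. -/
def RightReturn {α : Type*} (S : Set (List α)) (w : List α) : Set (List α) :=
  {u | CompleteFirstReturnWord S {w} (w ++ u)}

/-- `X` is a basis (free generating set) of the subgroup `H`: the canonical map
`FreeGroup X → G` is injective with range `H`. -/
def IsBasisOf {G : Type*} [Group G] (X : Set G) (H : Subgroup G) : Prop :=
  Function.Injective (FreeGroup.lift (fun x : X => (x : G))) ∧
    (FreeGroup.lift (fun x : X => (x : G)) : FreeGroup X →* G).range = H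

/-- `Y` is a symmetric basis of `H` if `Y = X ∪ X⁻¹` for some basis `X` of `H`. -/
def IsSymmetricBasisOf {G : Type*} [Group G] (Y : Set G) (H : Subgroup G) : Prop :=
  ∃ X : Set G, IsBasisOf X H ∧ Y = X ∪ X⁻¹

/-- The prime words in `S` with respect to a subgroup `G` of `F_A`: the
nonempty words of `G ∩ S` without a proper nonempty prefix in `G ∩ S`. -/
def PrimeWords {A : Type*} (S : Set (List (Letter A))) (G : Subgroup (FreeGroup A)) :
    Set (List (Letter A)) :=
  {u | u ∈ S ∧ u ≠ [] ∧ FreeGroup.mk u ∈ G ∧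
    ∀ p : List (Letter A), p <+: u → p ≠ [] → p ≠ u → ¬(p ∈ S ∧ FreeGroup.mk p ∈ G)}

section

open Filter Topology

@[simp]
lemma s2_s2 (z : ℝ × Bool) : s2 (s2 z) = z := by simp [s2]

lemma continuous_s2 : Continuous s2 :=
  continuous_fst.prodMk ((continuous_of_discreteTopology (f := not)).comp continuous_snd)

@[simp]
lemma Letter.inv_inv {A : Type*} (c : Letter A) : Letter.inv (Letter.inv c) = c := by
  simp [Letter.inv]

lemma Letter.inv_ne {A : Type*} (c : Letter A) : Letter.inv c ≠ c := by
  intro h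
  simpa [Letter.inv] using congrArg Prod.snd h

lemma mk_letter_inv {A : Type*} (c : Letter A) :
    FreeGroup.mk [Letter.inv c] = (FreeGroup.mk [c])⁻¹ := by
  simp [Letter.inv, FreeGroup.inv_mk, FreeGroup.invRev]

lemma freeGroup_induction {A : Type*} {p : FreeGroup A → Prop} (one : p 1)
    (mul : ∀ (c : Letter A) g, p g → p (FreeGroup.mk [c] * g)) (g : FreeGroup A) : p g := by
  obtain ⟨l, rfl⟩ := Quot.exists_rep g
  change p (FreeGroup.mk l)
  induction l with
  | nil => exact one
  | cons c l ih => exact FreeGroup.mul_mk (L₁ := [c]) (L₂ := l) ▸ mul c _ ih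

lemma inv_ne_of_isReduced {A : Type*} {u : List (A × Bool)} (hu : FreeGroup.IsReduced u)
    (h0 : u ≠ []) : (FreeGroup.mk u)⁻¹ ≠ FreeGroup.mk u := by
  classical
  intro h
  have h2 : FreeGroup.mk u ^ 2 = 1 ^ 2 := by
    rw [one_pow, pow_two, mul_eq_one_iff_inv_eq, h]
  have h1 : FreeGroup.mk u = 1 := pow_left_injective two_ne_zero h2
  have := congrArg FreeGroup.toWord h1
  rw [FreeGroup.toWord_mk, hu.reduce_eq, FreeGroup.toWord_one] at this
  exact h0 this

/-- A symmetric set without fixed point of the inversion splits as `X ∪ X⁻¹`, where `X` is disjoint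
from `X⁻¹`. -/
lemma exists_half {F : Type*} [Group F] {P : Set F} (hinv : ∀ g ∈ P, g⁻¹ ∈ P)
    (hne : ∀ g ∈ P, g⁻¹ ≠ g) : ∃ X : Set F, P = X ∪ X⁻¹ ∧ ∃ x : F → FreeGroup X,
      (∀ g, x g⁻¹ = (x g)⁻¹) ∧ ∀ g : X, x g = FreeGroup.of g := by
  classical
  let r : F → F → Prop := WellOrderingRel
  have htri : ∀ g ∈ P, r g g⁻¹ ∨ r g⁻¹ g := fun g hg => by
    rcases trichotomous_of r g g⁻¹ with h | h | h
    · exact Or.inl h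
    · exact absurd h.symm (hne g hg)
    · exact Or.inr h
  have hdisj : ∀ g, r g g⁻¹ → ¬ r g⁻¹ g := fun g h1 h2 => asymm_of r h1 h2
  refine ⟨{g | g ∈ P ∧ r g g⁻¹}, ?_, ?_⟩
  · ext g
    constructor
    · intro hg
      rcases htri g hg with h | h
      · exact Or.inl ⟨hg, h⟩
      · exact Or.inr ⟨hinv g hg, by rwa [inv_inv]⟩
    · rintro (hg | hg)
      · exact hg.1
      · simpa using hinv _ hg.1
  · set X : Set F := {g | g ∈ P ∧ r g g⁻¹}
    have hX : ∀ g ∈ X, g⁻¹ ∉ X := fun g h1 h2 => hdisj g h1.2 (by simpa using h2.2)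
    refine ⟨fun g => if h : g ∈ X then FreeGroup.of ⟨g, h⟩ else
      if h : g⁻¹ ∈ X then (FreeGroup.of ⟨g⁻¹, h⟩)⁻¹ else 1, fun g => ?_, fun g => ?_⟩
    · by_cases h1 : g ∈ X
      · simp [h1, hX g h1]
      · by_cases h2 : g⁻¹ ∈ X
        · simp [h1, h2]
        · simp [h1, h2]
    · simp [g.2]

namespace LinearInvolution

variable {A : Type*} [Fintype A] (L : LinearInvolution A)

/-- The domain `Î ∖ Σ` of the involution. -/
def dom : Set (ℝ × Bool) := L.Ihat \ L.Sig

variable {L} {z : ℝ × Bool} {c d : Letter A}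

lemma mem_Ihat : z ∈ L.Ihat ↔ L.lo < z.1 ∧ z.1 < L.hi := by
  simp [Ihat, Set.mem_prod]

lemma mem_Ia : z ∈ L.Ia c ↔ (L.endLo c < z.1 ∧ z.1 < L.endHi c) ∧ z.2 = L.comp c := by
  simp [Ia, Set.mem_prod]

lemma isOpen_Ia (c : Letter A) : IsOpen (L.Ia c) :=
  isOpen_Ioo.prod (isOpen_discrete _)

lemma s2_mem_Ihat : s2 z ∈ L.Ihat ↔ z ∈ L.Ihat := by
  simp [mem_Ihat, s2]

lemma mem_dom_iff : z ∈ L.dom ↔ ∃ c, z ∈ L.Ia c := by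
  have h := L.cover
  constructor
  · rintro ⟨h1, h2⟩
    have h3 : z ∈ (⋃ c, L.Ia c) ∪ L.Sig := by
      have : z ∈ Ioo L.lo L.hi ×ˢ (univ : Set Bool) := h1
      rw [h] at this
      exact this
    rcases h3 with h3 | h3
    · simpa using h3
    · exact absurd h3 h2
  · rintro ⟨c, hc⟩
    refine ⟨?_, fun hs => (Set.disjoint_left.1 (L.Sig_disj c)) hs hc⟩
    change z ∈ Ioo L.lo L.hi ×ˢ (univ : Set Bool)
    rw [h]
    exact Or.inl (Set.mem_iUnion.2 ⟨c, hc⟩)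

lemma mem_dom (h : z ∈ L.Ia c) : z ∈ L.dom := mem_dom_iff.2 ⟨c, h⟩

lemma mem_Ia_unique (hc : z ∈ L.Ia c) (hd : z ∈ L.Ia d) : c = d := by
  by_contra h
  exact Set.disjoint_left.1 (L.disj c d h) hc hd

@[simp]
lemma s2_T : s2 (L.T z) = L.s1 z := by simp [T]

lemma s1_mem (h : z ∈ L.Ia c) : L.s1 z ∈ L.Ia (Letter.inv c) := by
  have := L.s1_image c
  change L.s1 '' (L.Ia c) = L.Ia (Letter.inv c) at this
  rw [← this]
  exact Set.mem_image_of_mem _ h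

lemma s1_mem_dom (h : z ∈ L.dom) : L.s1 z ∈ L.dom := by
  obtain ⟨c, hc⟩ := mem_dom_iff.1 h
  exact mem_dom (s1_mem hc)

lemma T_mem_Ihat (h : z ∈ L.dom) : L.T z ∈ L.Ihat :=
  s2_mem_Ihat.2 (s1_mem_dom h).1

lemma s1_s1 (h : z ∈ L.dom) : L.s1 (L.s1 z) = z := L.s1_invol z h

lemma T_s1 (h : z ∈ L.dom) : L.T (L.s1 z) = s2 z := by
  rw [T, s1_s1 h]

lemma T_injOn : Set.InjOn L.T L.dom := by
  intro x hx y hy h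
  have : L.s1 x = L.s1 y := by rw [← s2_T, ← s2_T, h]
  rw [← s1_s1 hx, this, s1_s1 hy]

lemma T_affine (c : Letter A) : ∃ s α : ℝ, (s = 1 ∨ s = -1) ∧
    ∀ z ∈ L.Ia c, L.T z = (s * z.1 + α, !L.comp (Letter.inv c)) := by
  rcases L.s1_iso c with ⟨α, h⟩ | ⟨α, h⟩
  · exact ⟨1, α, Or.inl rfl, fun z hz => by simp [T, h z hz, s2]⟩
  · exact ⟨-1, α, Or.inr rfl, fun z hz => by simp [T, h z hz, s2]⟩

lemma continuousAt_T (h : z ∈ L.dom) : ContinuousAt L.T z := by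
  obtain ⟨c, hc⟩ := mem_dom_iff.1 h
  obtain ⟨s, α, -, h⟩ := L.T_affine c
  have hcont : Continuous fun z : ℝ × Bool => (s * z.1 + α, !L.comp (Letter.inv c)) := by
    fun_prop
  exact hcont.continuousAt.congr
    (Filter.eventually_of_mem ((isOpen_Ia c).mem_nhds hc) fun y hy => (h y hy).symm)

/-- Without connection, a letter of a one-letter alphabet has its two intervals in distinct
components. -/
lemma comp_ne_of_forall_letter (hnc : ¬ L.HasConnection) (c : Letter A)
    (hc : ∀ d : Letter A, d = c ∨ d = Letter.inv c) : L.comp (Letter.inv c) ≠ L.comp c := by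
  intro he
  have hsub : ∀ t ∈ Ioo L.lo L.hi, (t, L.comp c) ∈ L.dom := by
    intro t ht
    refine ⟨mem_Ihat.2 ht, fun hs => hnc ⟨s2 (t, L.comp c), ⟨_, hs, rfl⟩, 0, ?_⟩⟩
    by_contra hn
    obtain ⟨d, hd⟩ := mem_dom_iff.1 (⟨s2_mem_Ihat.2 (mem_Ihat.2 ht), hn⟩ :
      s2 (t, L.comp c) ∈ L.dom)
    have h1 := (mem_Ia.1 hd).2
    rcases hc d with rfl | rfl
    · simp [s2] at h1
    · simp [s2, he] at h1
  have hcov : Ioo L.lo L.hi ⊆ Ioo (L.endLo c) (L.endHi c) ∪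
      Ioo (L.endLo (Letter.inv c)) (L.endHi (Letter.inv c)) := by
    intro t ht
    obtain ⟨d, hd⟩ := mem_dom_iff.1 (hsub t ht)
    rcases hc d with rfl | rfl
    · exact Or.inl (mem_Ia.1 hd).1
    · exact Or.inr (mem_Ia.1 hd).1
  have hne : ∀ d : Letter A, (Ioo L.lo L.hi ∩ Ioo (L.endLo d) (L.endHi d)).Nonempty := by
    intro d
    obtain ⟨t, ht⟩ := exists_between (L.end_lt d)
    exact ⟨t, ⟨(L.sub_lo d).trans_lt ht.1, ht.2.trans_le (L.sub_hi d)⟩, ht⟩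
  obtain ⟨t, -, h1, h2⟩ := isPreconnected_Ioo _ _ isOpen_Ioo isOpen_Ioo hcov
    (hne c) (hne (Letter.inv c))
  exact (Letter.inv_ne c) (mem_Ia_unique (z := (t, L.comp c)) (mem_Ia.2 ⟨h2, he.symm⟩)
    (mem_Ia.2 ⟨h1, rfl⟩))

/-- Without connection, there is no division point when the alphabet has one letter. -/
lemma Sig_eq_empty_of_forall_letter (hnc : ¬ L.HasConnection) (c : Letter A)
    (hc : ∀ d : Letter A, d = c ∨ d = Letter.inv c) : L.Sig = ∅ := by
  rw [Set.eq_empty_iff_forall_notMem]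
  intro y hy
  have key : ∀ c : Letter A, (∀ d : Letter A, d = c ∨ d = Letter.inv c) → s2 y ∉ L.Ia c := by
    intro c hc hmem
    have hcomp := comp_ne_of_forall_letter hnc c hc
    have hinv : ∀ n, (L.T)^[n] (s2 y) ∈ L.Ia c := by
      intro n
      induction n with
      | zero => exact hmem
      | succ n ih =>
        have hd : (L.T)^[n + 1] (s2 y) ∈ L.dom := by
          refine ⟨?_, fun hs => hnc ⟨_, ⟨y, hy, rfl⟩, n + 1, hs⟩⟩
          rw [Function.iterate_succ_apply']
          exact T_mem_Ihat (mem_dom ih)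
        obtain ⟨d, hd⟩ := mem_dom_iff.1 hd
        rcases hc d with rfl | rfl
        · exact hd
        · exfalso
          have h1 := (mem_Ia.1 hd).2
          have h2 := (mem_Ia.1 (s1_mem ih)).2
          rw [← s2_T, ← Function.iterate_succ_apply' L.T, s2, h1] at h2
          simp at h2
    have hfix : ∀ n, 1 ≤ n → (L.T)^[n] (s2 y) ≠ s2 y := by
      intro n hn h
      obtain ⟨m, rfl⟩ : ∃ m, n = m + 1 := ⟨n - 1, by omega⟩
      rw [Function.iterate_succ_apply'] at h
      have h1 := s1_mem (hinv m)
      rw [← s2_T, h, s2_s2] at h1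
      exact (mem_dom h1).2 hy
    obtain ⟨s, α, hs, h⟩ := L.T_affine c
    rcases hs with rfl | rfl
    · have hfst : ∀ n : ℕ, ((L.T)^[n] (s2 y)).1 = (s2 y).1 + n * α := by
        intro n
        induction n with
        | zero => simp
        | succ n ih =>
          rw [Function.iterate_succ_apply', h _ (hinv n)]
          push_cast
          simp only [ih]
          ring
      have hα : α ≠ 0 := by
        rintro rfl
        refine hfix 1 le_rfl (Prod.ext ?_ ?_)
        · rw [hfst 1]; simp
        · rw [(mem_Ia.1 (hinv 1)).2, (mem_Ia.1 hmem).2]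
      obtain ⟨n, hn⟩ := exists_nat_gt ((L.endHi c - L.endLo c) / |α|)
      rw [div_lt_iff₀ (abs_pos.2 hα)] at hn
      have h0 := (mem_Ia.1 hmem).1
      have h1 := (mem_Ia.1 (hinv n)).1
      rw [hfst] at h1
      have : |(n : ℝ) * α| < L.endHi c - L.endLo c := by
        rw [abs_lt]
        constructor <;> linarith [h0.1, h0.2, h1.1, h1.2]
      rw [abs_mul, Nat.abs_cast] at this
      linarith
    · refine hfix 2 (by norm_num) (Prod.ext ?_ ?_)
      · have h1 : (L.T)^[1] (s2 y) = _ := h _ (hinv 0)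
        rw [Function.iterate_succ_apply', h _ (hinv 1), h1]
        simp
      · rw [(mem_Ia.1 (hinv 2)).2, (mem_Ia.1 hmem).2]
  have hd : s2 y ∈ L.dom :=
    ⟨s2_mem_Ihat.2 (L.Sig_sub hy), fun hs => hnc ⟨_, ⟨y, hy, rfl⟩, 0, hs⟩⟩
  obtain ⟨d, hd⟩ := mem_dom_iff.1 hd
  rcases hc d with rfl | rfl
  · exact key _ hc hd
  · refine key _ (fun e => ?_) hd
    rw [Letter.inv_inv]
    exact (hc e).symm

lemma finite_Sig (hnc : ¬ L.HasConnection) : L.Sig.Finite := by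
  by_cases h : 2 ≤ Fintype.card A
  · refine Set.finite_of_ncard_pos ?_
    rw [L.Sig_card]
    omega
  rcases isEmpty_or_nonempty A with hA | ⟨⟨a⟩⟩
  · exfalso
    have hS : ∀ z ∈ L.Ihat, z ∈ L.Sig := by
      intro z hz
      by_contra hn
      obtain ⟨c, -⟩ := mem_dom_iff.1 (⟨hz, hn⟩ : z ∈ L.dom)
      exact hA.elim c.1
    obtain ⟨t, ht⟩ := exists_between L.lo_lt_hi
    have h1 : (t, true) ∈ L.Ihat := mem_Ihat.2 ht
    exact hnc ⟨s2 (t, true), ⟨_, hS _ h1, rfl⟩, 0, hS _ (s2_mem_Ihat.2 h1)⟩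
  · have hsub : Subsingleton A := Fintype.card_le_one_iff_subsingleton.1 (by omega)
    rw [Sig_eq_empty_of_forall_letter hnc (a, true)]
    · exact Set.finite_empty
    · rintro ⟨d, e⟩
      rw [Subsingleton.elim d a]
      cases e <;> simp [Letter.inv]

end LinearInvolution

namespace LinearInvolution

variable {A : Type*} [Fintype A] {L : LinearInvolution A} {z : ℝ × Bool} {c d : Letter A}

open Classical in
/-- The generator of the free group attached to the interval containing `z`. -/
noncomputable def elt (L : LinearInvolution A) (z : ℝ × Bool) : FreeGroup A :=
  if h : ∃ c, z ∈ L.Ia c then FreeGroup.mk [h.choose] else 1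

lemma elt_eq (h : z ∈ L.Ia c) : L.elt z = FreeGroup.mk [c] := by
  have hex : ∃ c, z ∈ L.Ia c := ⟨c, h⟩
  rw [elt, dif_pos hex, mem_Ia_unique hex.choose_spec h]

lemma elt_s1 (h : z ∈ L.dom) : L.elt (L.s1 z) = (L.elt z)⁻¹ := by
  obtain ⟨c, hc⟩ := mem_dom_iff.1 h
  rw [elt_eq hc, elt_eq (s1_mem hc), mk_letter_inv]

/-- The element of the free group coding the first `n` steps of the orbit of `z`. -/
noncomputable def cod (L : LinearInvolution A) : ℝ × Bool → ℕ → FreeGroup A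
  | _, 0 => 1
  | z, n + 1 => L.elt z * cod L (L.T z) n

@[simp]
lemma cod_zero : L.cod z 0 = 1 := rfl

lemma cod_succ (n : ℕ) : L.cod z (n + 1) = L.elt z * L.cod (L.T z) n := rfl

lemma cod_add (m n : ℕ) : L.cod z (m + n) = L.cod z m * L.cod ((L.T)^[m] z) n := by
  induction m generalizing z with
  | zero => simp
  | succ m ih =>
    rw [show m + 1 + n = (m + n) + 1 by omega, cod_succ, ih, cod_succ, mul_assoc,
      Function.iterate_succ_apply]

lemma cod_succ' (n : ℕ) : L.cod z (n + 1) = L.cod z n * L.elt ((L.T)^[n] z) := by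
  rw [cod_add, cod_succ, cod_zero, mul_one]

/-- The first `n` points of the orbit of `x` avoid the division points. -/
def Reg (L : LinearInvolution A) (n : ℕ) (x : ℝ × Bool) : Prop :=
  ∀ i < n, (L.T)^[i] x ∈ L.dom

variable {x : ℝ × Bool} {n m : ℕ}

lemma Reg.mono (h : L.Reg n x) (hmn : m ≤ n) : L.Reg m x := fun i hi => h i (hi.trans_le hmn)

lemma reg_succ : L.Reg (n + 1) x ↔ x ∈ L.dom ∧ L.Reg n (L.T x) := by
  constructor
  · exact fun h => ⟨h 0 n.succ_pos, fun i hi => h (i + 1) (by omega)⟩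
  · rintro ⟨h0, h⟩ (_ | i) hi
    · exact h0
    · exact h i (by omega)

lemma Reg.mem_Ihat (h : L.Reg n x) (hx : x ∈ L.Ihat) {i : ℕ} (hi : i ≤ n) :
    (L.T)^[i] x ∈ L.Ihat := by
  cases i with
  | zero => exact hx
  | succ i =>
    rw [Function.iterate_succ_apply']
    exact T_mem_Ihat (h i hi)

lemma Reg.s2_iterate (h : L.Reg n x) : (L.T)^[n] (s2 ((L.T)^[n] x)) = s2 x := by
  induction n with
  | zero => rfl
  | succ n ih =>
    rw [Function.iterate_succ_apply' L.T n x, s2_T, Function.iterate_succ_apply,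
      T_s1 (h n n.lt_succ_self), ih (h.mono n.le_succ)]

lemma Reg.cod_s2 (h : L.Reg n x) : L.cod (s2 ((L.T)^[n] x)) n = (L.cod x n)⁻¹ := by
  induction n with
  | zero => simp
  | succ n ih =>
    rw [Function.iterate_succ_apply' L.T n x, s2_T, cod_succ, T_s1 (h n n.lt_succ_self),
      ih (h.mono n.le_succ), elt_s1 (h n n.lt_succ_self), cod_succ', mul_inv_rev]

/-- Points whose orbit reaches a division point for the first time after `n` steps. -/
def firstSing (L : LinearInvolution A) (n : ℕ) : Set (ℝ × Bool) :=
  {x | x ∈ L.Ihat ∧ L.Reg n x ∧ (L.T)^[n] x ∈ L.Sig}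

lemma exists_firstSing (hx : x ∈ L.Ihat) (h : (L.T)^[n] x ∉ L.dom) :
    ∃ m ≤ n, x ∈ L.firstSing m := by
  classical
  have hex : ∃ n, (L.T)^[n] x ∉ L.dom := ⟨n, h⟩
  have hreg : L.Reg (Nat.find hex) x := fun i hi => not_not.1 (Nat.find_min hex hi)
  refine ⟨Nat.find hex, Nat.find_min' hex h, hx, hreg, ?_⟩
  by_contra hs
  exact Nat.find_spec hex ⟨hreg.mem_Ihat hx le_rfl, hs⟩

lemma injOn_iterate (n : ℕ) : Set.InjOn (L.T)^[n] {x | L.Reg n x} := by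
  induction n with
  | zero => exact fun x _ y _ h => h
  | succ n ih =>
    intro x hx y hy h
    have hx' := reg_succ.1 hx
    have hy' := reg_succ.1 hy
    exact T_injOn hx'.1 hy'.1 (ih hx'.2 hy'.2 h)

lemma finite_firstSing (hnc : ¬ L.HasConnection) (n : ℕ) : (L.firstSing n).Finite :=
  Set.Finite.of_injOn (f := (L.T)^[n]) (fun _ hx => hx.2.2)
    (fun _ hx _ hy h => injOn_iterate n hx.2.1 hy.2.1 h) (finite_Sig hnc)

/-- Without connection, either the forward orbit of `x` or that of `s2 x` avoids `Σ`. -/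
lemma regular_or_regular (hnc : ¬ L.HasConnection) (hx : x ∈ L.Ihat) :
    (∀ n, L.Reg n x) ∨ ∀ n, L.Reg n (s2 x) := by
  by_contra! hcon
  obtain ⟨⟨n, hn⟩, ⟨m, hm⟩⟩ := hcon
  simp only [Reg, not_forall] at hn hm
  obtain ⟨n, -, hn⟩ := hn
  obtain ⟨m, -, hm⟩ := hm
  obtain ⟨n, -, -, hn, hns⟩ := exists_firstSing hx hn
  obtain ⟨m, -, -, hm, hms⟩ := exists_firstSing (s2_mem_Ihat.2 hx) hm
  refine hnc ⟨_, ⟨_, hns, rfl⟩, m + n, ?_⟩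
  rwa [Function.iterate_add_apply, hn.s2_iterate]

/-- The points at which the infinite natural coding is considered. -/
def Gen (L : LinearInvolution A) : Set (ℝ × Bool) := L.Ihat \ L.Ohat

lemma mem_Gen_iff : z ∈ L.Gen ↔ z ∈ L.Ihat ∧ (∀ n, (L.T)^[n] z ∉ L.Sig) ∧
    ∀ n, (L.T)^[n] (s2 z) ∉ L.Sig := by
  have h2 : z ∈ s2 '' L.O ↔ s2 z ∈ L.O :=
    ⟨by rintro ⟨y, hy, rfl⟩; rwa [s2_s2], fun h => ⟨_, h, s2_s2 z⟩⟩
  rw [Gen, Ohat, Set.mem_sdiff, Set.mem_union, h2]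
  simp [O]

lemma s2_mem_Gen (h : z ∈ L.Gen) : s2 z ∈ L.Gen := by
  rw [mem_Gen_iff] at *
  refine ⟨s2_mem_Ihat.2 h.1, h.2.2, ?_⟩
  rw [s2_s2]
  exact h.2.1

lemma Gen.mem_Ihat (h : z ∈ L.Gen) : z ∈ L.Ihat := h.1

lemma Gen.mem_dom (h : z ∈ L.Gen) : z ∈ L.dom := ⟨h.1, (mem_Gen_iff.1 h).2.1 0⟩

lemma T_mem_Gen (h : z ∈ L.Gen) : L.T z ∈ L.Gen := by
  have hd := Gen.mem_dom h
  rw [mem_Gen_iff] at *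
  refine ⟨T_mem_Ihat hd, fun n => h.2.1 (n + 1), ?_⟩
  rintro (_ | n)
  · rw [s2_T]
    exact (s1_mem_dom hd).2
  · rw [s2_T, Function.iterate_succ_apply, T_s1 hd]
    exact h.2.2 n

lemma iterate_mem_Gen (h : z ∈ L.Gen) (n : ℕ) : (L.T)^[n] z ∈ L.Gen := by
  induction n with
  | zero => exact h
  | succ n ih =>
    rw [Function.iterate_succ_apply']
    exact T_mem_Gen ih

lemma Gen.reg (h : z ∈ L.Gen) (n : ℕ) : L.Reg n z :=
  fun i _ => Gen.mem_dom (iterate_mem_Gen h i)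

lemma countable_Ihat_diff_Gen (hnc : ¬ L.HasConnection) : (L.Ihat \ L.Gen).Countable := by
  have hU : (⋃ n, L.firstSing n).Countable :=
    Set.countable_iUnion fun n => (finite_firstSing hnc n).countable
  refine (hU.union (hU.image s2)).mono ?_
  rintro z ⟨hz, hg⟩
  simp only [mem_Gen_iff, hz, true_and, not_and_or, not_forall, not_not] at hg
  rcases hg with ⟨n, hn⟩ | ⟨n, hn⟩
  · obtain ⟨m, -, hm⟩ := exists_firstSing hz (fun h => h.2 hn)
    exact Or.inl (Set.mem_iUnion.2 ⟨m, hm⟩)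
  · obtain ⟨m, -, hm⟩ := exists_firstSing (s2_mem_Ihat.2 hz) (fun h => h.2 hn)
    exact Or.inr ⟨_, Set.mem_iUnion.2 ⟨m, hm⟩, s2_s2 z⟩

lemma exists_mem_Gen (hnc : ¬ L.HasConnection) {U : Set (ℝ × Bool)} (hU : IsOpen U)
    (hx : x ∈ L.Ihat) (hxU : x ∈ U) : ∃ z ∈ L.Gen, z ∈ U ∧ z.2 = x.2 := by
  have hd : Dense (Prod.fst '' (L.Ihat \ L.Gen))ᶜ :=
    ((countable_Ihat_diff_Gen hnc).image _).dense_compl ℝ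
  have hopen : IsOpen ({s | (s, x.2) ∈ U} ∩ Ioo L.lo L.hi) :=
    (hU.preimage (by fun_prop : Continuous fun s : ℝ => (s, x.2))).inter isOpen_Ioo
  obtain ⟨s, hs, hsU⟩ := hd.exists_mem_open hopen ⟨x.1, hxU, LinearInvolution.mem_Ihat.1 hx⟩
  refine ⟨(s, x.2), ?_, hsU.1, rfl⟩
  by_contra hg
  exact hs ⟨_, ⟨(LinearInvolution.mem_Ihat (z := (s, x.2))).2 hsU.2, hg⟩, rfl⟩

lemma nhdsWithin_Gen_neBot (hnc : ¬ L.HasConnection) (hx : x ∈ L.Ihat) :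
    (𝓝[L.Gen] x).NeBot := by
  rw [← mem_closure_iff_nhdsWithin_neBot, mem_closure_iff]
  intro U hU hxU
  obtain ⟨z, hz, hzU, -⟩ := exists_mem_Gen hnc hU hx hxU
  exact ⟨z, hzU, hz⟩

lemma eventually_elt_eq (hx : x ∈ L.dom) : ∀ᶠ z in 𝓝 x, L.elt z = L.elt x := by
  obtain ⟨c, hc⟩ := mem_dom_iff.1 hx
  filter_upwards [(isOpen_Ia c).mem_nhds hc] with z hz
  rw [elt_eq hz, elt_eq hc]

lemma Reg.eventually_cod_eq (h : L.Reg n x) : ∀ᶠ z in 𝓝 x, L.cod z n = L.cod x n := by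
  induction n generalizing x with
  | zero => simp
  | succ n ih =>
    have h' := reg_succ.1 h
    filter_upwards [(continuousAt_T h'.1).eventually (ih h'.2), eventually_elt_eq h'.1] with z h1 h2
    rw [cod_succ, cod_succ, h1, h2]

lemma Reg.eventually_cod_eq_le (h : L.Reg n x) :
    ∀ᶠ z in 𝓝 x, ∀ i ≤ n, L.cod z i = L.cod x i :=
  (Filter.eventually_all_finite (Set.finite_Iic n)).2 fun _ hi => (h.mono hi).eventually_cod_eq

/-- A function which is locally constant on generic points is constant on the generic points of an
interval. -/
lemma const_of_locally (hnc : ¬ L.HasConnection) {α : Type*} {a b : ℝ}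
    (hab : Ioo a b ⊆ Ioo L.lo L.hi) {β : Bool} {f : ℝ × Bool → α}
    (h : ∀ t ∈ Ioo a b, ∃ v, ∀ᶠ z in 𝓝[L.Gen] (t, β), f z = v) :
    ∃ v, ∀ z ∈ L.Gen, z.1 ∈ Ioo a b → z.2 = β → f z = v := by
  rcases (Ioo a b).eq_empty_or_nonempty with he | ⟨t₀, ht₀⟩
  · refine ⟨f (0, true), fun z _ hz => ?_⟩
    rw [he] at hz
    exact hz.elim
  have : Nonempty α := ⟨f (0, true)⟩
  choose! v hv using h
  let _ : TopologicalSpace α := ⊥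
  have : DiscreteTopology α := ⟨rfl⟩
  have hcont : ContinuousOn v (Ioo a b) := by
    intro t ht
    have h1 : ∀ᶠ s in 𝓝 t, ∀ᶠ z in 𝓝 (s, β), z ∈ L.Gen → f z = v t :=
      (by fun_prop : Continuous fun s : ℝ => (s, β)).continuousAt.eventually
        (eventually_eventually_nhds.2 (eventually_nhdsWithin_iff.1 (hv t ht)))
    have h2 : ∀ᶠ s in 𝓝[Ioo a b] t, v s = v t := by
      filter_upwards [nhdsWithin_le_nhds h1, self_mem_nhdsWithin] with s hs hsab
      have hne := nhdsWithin_Gen_neBot hnc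
        (LinearInvolution.mem_Ihat.2 (hab hsab) : (s, β) ∈ L.Ihat)
      obtain ⟨z, hz1, hz2⟩ := ((eventually_nhdsWithin_iff.2 hs).and (hv s hsab)).exists
      rw [← hz1, ← hz2]
    exact tendsto_const_nhds.congr' (h2.mono fun _ h => h.symm)
  refine ⟨v t₀, fun z hz hzab hzβ => ?_⟩
  rw [isPreconnected_Ioo.constant hcont ht₀ hzab]
  have : (z.1, β) = z := by rw [← hzβ]
  have h1 := hv z.1 hzab
  rw [this] at h1
  exact (eventually_nhdsWithin_iff.1 h1).self_of_nhds hz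

/-- An `s2`-invariant function which is locally constant near regular points is constant. -/
lemma const_of_s2_invariant (hnc : ¬ L.HasConnection) {α : Type*} {f : ℝ × Bool → α}
    (hs : ∀ z ∈ L.Gen, f (s2 z) = f z)
    (h : ∀ x ∈ L.Ihat, (∀ n, L.Reg n x) → ∃ v, ∀ᶠ z in 𝓝[L.Gen] x, f z = v) :
    ∃ v, ∀ z ∈ L.Gen, f z = v := by
  obtain ⟨v, hv⟩ := const_of_locally hnc subset_rfl (β := true) (f := f) fun t ht => by
    have hI : (t, true) ∈ L.Ihat := LinearInvolution.mem_Ihat.2 ht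
    rcases regular_or_regular hnc hI with hr | hr
    · exact h _ hI hr
    · obtain ⟨v, hv⟩ := h _ (s2_mem_Ihat.2 hI) hr
      refine ⟨v, eventually_nhdsWithin_iff.2 ?_⟩
      filter_upwards [continuous_s2.continuousAt.eventually (eventually_nhdsWithin_iff.1 hv)]
        with z hz hzg
      rw [← hs z hzg, hz (s2_mem_Gen hzg)]
  refine ⟨v, fun z hz => ?_⟩
  have hz1 := LinearInvolution.mem_Ihat.1 (Gen.mem_Ihat hz)
  cases hβ : z.2
  · rw [← hs z hz]
    exact hv _ (s2_mem_Gen hz) hz1 (by simp [s2, hβ])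
  · exact hv z hz hz1 hβ

end LinearInvolution

namespace LinearInvolution

variable {A : Type*} [Fintype A] {L : LinearInvolution A} {z : ℝ × Bool} {c d : Letter A}

variable {x y : ℝ × Bool} {n m : ℕ}

lemma subset_Ia_of_isPreconnected {s : Set (ℝ × Bool)} (hs : IsPreconnected s) (hd : s ⊆ L.dom)
    (hz : z ∈ s) (hc : z ∈ L.Ia c) : s ⊆ L.Ia c := by
  refine hs.subset_left_of_subset_union (v := ⋃ d ≠ c, L.Ia d) (isOpen_Ia c)
    (isOpen_biUnion fun d _ => isOpen_Ia d) ?_ ?_ ⟨z, hz, hc⟩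
  · rw [Set.disjoint_iUnion₂_right]
    exact fun d hdc => Set.disjoint_left.2 fun y h1 h2 => hdc (mem_Ia_unique h2 h1)
  · intro y hy
    obtain ⟨d, hd⟩ := mem_dom_iff.1 (hd hy)
    by_cases h : d = c
    · exact Or.inl (h ▸ hd)
    · exact Or.inr (Set.mem_biUnion h hd)

lemma exists_adjacent {F : Set ℝ} (hF : F.Finite) {l h t : ℝ} (hl : l ∈ F) (hh : h ∈ F)
    (hlt : l < t) (hth : t < h) (ht : t ∉ F) :
    ∃ a ∈ F, ∃ b ∈ F, t ∈ Ioo a b ∧ ∀ s ∈ Ioo a b, s ∉ F := by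
  obtain ⟨a, ⟨haF, hat⟩, ha⟩ := Set.exists_max_image (F ∩ Iio t) id
    (hF.subset Set.inter_subset_left) ⟨l, hl, hlt⟩
  obtain ⟨b, ⟨hbF, hbt⟩, hb⟩ := Set.exists_min_image (F ∩ Ioi t) id
    (hF.subset Set.inter_subset_left) ⟨h, hh, hth⟩
  refine ⟨a, haF, b, hbF, ⟨hat, hbt⟩, fun s hs hsF => ?_⟩
  rcases lt_trichotomy s t with h | h | h
  · exact absurd hs.1 (not_lt.2 (ha s ⟨hsF, h⟩))
  · exact ht (h ▸ hsF)
  · exact absurd hs.2 (not_lt.2 (hb s ⟨hsF, h⟩))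

variable {Q : Type*} [MulAction (FreeGroup A) Q] {b q : Q}

lemma return_of_iterate_eq (hx : L.Reg n x) (hy : L.Reg m y) (hnm : n ≤ m)
    (hT : (L.T)^[n] x = (L.T)^[m] y) (hq : (L.cod x n)⁻¹ • b = (L.cod y m)⁻¹ • b) :
    x = (L.T)^[m - n] y ∧ (L.cod y (m - n))⁻¹ • b = b := by
  obtain ⟨k, rfl⟩ : ∃ k, m = k + n := ⟨m - n, by omega⟩
  rw [Nat.add_sub_cancel] at *
  have hy' : L.Reg n ((L.T)^[k] y) := fun i hi => by
    rw [← Function.iterate_add_apply]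
    exact hy _ (by omega)
  have hxy : x = (L.T)^[k] y := by
    rw [Nat.add_comm, Function.iterate_add_apply] at hT
    exact injOn_iterate n hx hy' hT
  refine ⟨hxy, ?_⟩
  rw [cod_add, mul_inv_rev, mul_smul, ← hxy] at hq
  exact (MulAction.injective _ hq).symm

/-- Points which reach a division point before their coding returns to the stabilizer of `b`. -/
def noReturn (L : LinearInvolution A) (b : Q) : Set (ℝ × Bool) :=
  {x | ∃ n, x ∈ L.firstSing n ∧ ∀ i, 1 ≤ i → i ≤ n → (L.cod x i)⁻¹ • b ≠ b}

lemma finite_noReturn [Finite Q] (hnc : ¬ L.HasConnection) (b : Q) : (L.noReturn b).Finite := by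
  classical
  choose! n hn using fun x (hx : x ∈ L.noReturn b) => hx
  refine Set.Finite.of_injOn (f := fun x => ((L.T)^[n x] x, (L.cod x (n x))⁻¹ • b))
    (t := L.Sig ×ˢ (univ : Set Q)) (fun x hx => ⟨(hn x hx).1.2.2, trivial⟩) ?_
    ((finite_Sig hnc).prod Set.finite_univ)
  have key : ∀ x ∈ L.noReturn b, ∀ y ∈ L.noReturn b, n x ≤ n y → (L.T)^[n x] x = (L.T)^[n y] y →
      (L.cod x (n x))⁻¹ • b = (L.cod y (n y))⁻¹ • b → x = y := by
    intro x hx y hy hxy hT hq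
    obtain ⟨h1, h2⟩ := return_of_iterate_eq (hn x hx).1.2.1 (hn y hy).1.2.1 hxy hT hq
    have h0 : n y - n x = 0 := by
      by_contra h0
      exact (hn y hy).2 _ (Nat.one_le_iff_ne_zero.2 h0) (Nat.sub_le _ _) h2
    rw [h1, h0]
    rfl
  intro x hx y hy h
  simp only [Prod.mk.injEq] at h
  rcases le_total (n x) (n y) with hxy | hxy
  · exact key x hx y hy hxy h.1 h.2
  · exact (key y hy x hx hxy h.1.symm h.2.symm).symm

lemma affine_of_forall_notMem_noReturn {a e : ℝ} (hae : Ioo a e ⊆ Ioo L.lo L.hi)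
    (hz : z.1 ∈ Ioo a e) (hB : ∀ t ∈ Ioo a e, (t, z.2) ∉ L.noReturn b)
    (hret : ∀ i, 1 ≤ i → i ≤ n → (L.cod z i)⁻¹ • b ≠ b) :
    ∃ s α : ℝ, (s = 1 ∨ s = -1) ∧ ∀ t ∈ Ioo a e, L.Reg n (t, z.2) ∧
      (∀ i ≤ n, L.cod (t, z.2) i = L.cod z i) ∧
      (L.T)^[n] (t, z.2) = (s * t + α, ((L.T)^[n] z).2) := by
  induction n with
  | zero => exact ⟨1, 0, Or.inl rfl, fun t _ => ⟨fun i hi => absurd hi i.not_lt_zero,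
      fun i hi => by rw [Nat.le_zero.1 hi]; rfl, by simp⟩⟩
  | succ n ih =>
    obtain ⟨s, α, hs, h⟩ := ih fun i h1 h2 => hret i h1 (h2.trans n.le_succ)
    have hdom : ∀ t ∈ Ioo a e, (L.T)^[n] (t, z.2) ∈ L.dom := by
      intro t ht
      obtain ⟨h1, h2, -⟩ := h t ht
      have hI : (t, z.2) ∈ L.Ihat := mem_Ihat.2 (hae ht)
      refine ⟨h1.mem_Ihat hI le_rfl, fun hS => hB t ht ⟨n, ⟨hI, h1, hS⟩, fun i hi hin => ?_⟩⟩
      rw [h2 i hin]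
      exact hret i hi (hin.trans n.le_succ)
    obtain ⟨c, hc⟩ := mem_dom_iff.1 (hdom z.1 hz)
    have hpre : IsPreconnected ((fun t : ℝ => (s * t + α, ((L.T)^[n] z).2)) '' Ioo a e) :=
      isPreconnected_Ioo.image _ (by fun_prop)
    have hsub : (fun t : ℝ => (s * t + α, ((L.T)^[n] z).2)) '' Ioo a e ⊆ L.Ia c := by
      refine subset_Ia_of_isPreconnected hpre ?_ ⟨z.1, hz, (h z.1 hz).2.2.symm⟩ hc
      rintro _ ⟨t, ht, rfl⟩
      have := hdom t ht
      rwa [(h t ht).2.2] at this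
    have hIa : ∀ t ∈ Ioo a e, (L.T)^[n] (t, z.2) ∈ L.Ia c := by
      intro t ht
      rw [(h t ht).2.2]
      exact hsub ⟨t, ht, rfl⟩
    obtain ⟨s', α', hs', hT⟩ := L.T_affine c
    refine ⟨s' * s, s' * α + α', ?_, fun t ht => ⟨?_, ?_, ?_⟩⟩
    · rcases hs with rfl | rfl <;> rcases hs' with rfl | rfl <;> norm_num
    · intro i hi
      rcases Nat.lt_succ_iff_lt_or_eq.1 hi with hi | rfl
      · exact (h t ht).1 i hi
      · exact hdom t ht
    · intro i hi
      rcases Nat.le_succ_iff.1 hi with hi | rfl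
      · exact (h t ht).2.1 i hi
      · rw [cod_succ', cod_succ', (h t ht).2.1 n le_rfl, elt_eq (hIa t ht), elt_eq hc]
    · have hz2 : (L.T)^[n + 1] z = _ := (Function.iterate_succ_apply' L.T n z).trans (hT _ hc)
      rw [Function.iterate_succ_apply', hT _ (hIa t ht), hz2, (h t ht).2.2]
      refine Prod.ext ?_ rfl
      ring

/-- The coding of every generic point returns to the stabilizer of `b` in bounded time. -/
lemma exists_return_bound [Finite Q] (hnc : ¬ L.HasConnection) (b : Q) :
    ∃ N, ∀ z ∈ L.Gen, ∃ n, 1 ≤ n ∧ n ≤ N ∧ (L.cod z n)⁻¹ • b = b := by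
  classical
  set F : Set ℝ := Prod.fst '' L.noReturn b ∪ {L.lo, L.hi} with hFdef
  have hF : F.Finite := ((finite_noReturn hnc b).image _).union (by simp)
  have hlo : L.lo ∈ F := Or.inr (by simp)
  have hhi : L.hi ∈ F := Or.inr (by simp)
  set δ := F.infsep with hδdef
  have hδ : 0 < δ := hF.infsep_pos_iff_nontrivial.2 ⟨_, hlo, _, hhi, L.lo_lt_hi.ne⟩
  have hgen : ∀ z ∈ L.Gen, z.1 ∉ F := by
    rintro z hz (⟨x, ⟨n, hx, -⟩, hxz⟩ | h)
    · rcases eq_or_ne x.2 z.2 with h2 | h2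
      · obtain rfl : x = z := Prod.ext hxz h2
        exact (mem_Gen_iff.1 hz).2.1 n hx.2.2
      · obtain rfl : x = s2 z := Prod.ext hxz (by simpa [s2] using Bool.eq_not_of_ne h2)
        exact (mem_Gen_iff.1 hz).2.2 n hx.2.2
    · have := mem_Ihat.1 (Gen.mem_Ihat hz)
      rcases h with h | h
      · exact this.1.ne' h
      · exact this.2.ne h
  set K := ⌊(L.hi - L.lo) / (δ / 2)⌋₊ with hK
  cases nonempty_fintype Q
  refine ⟨Fintype.card (Q × Bool × Fin (K + 1)), fun z hz => ?_⟩
  by_contra! hret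
  have hzI := mem_Ihat.1 (Gen.mem_Ihat hz)
  obtain ⟨a, haF, e, heF, hzae, hnot⟩ := exists_adjacent hF hlo hhi hzI.1 hzI.2 (hgen z hz)
  have hae : a < e := hzae.1.trans hzae.2
  have hδe : δ ≤ e - a := by
    have := Set.infsep_le_dist_of_mem haF heF hae.ne
    rwa [dist_comm, Real.dist_eq, abs_of_pos (sub_pos.2 hae)] at this
  have hsub : Ioo a e ⊆ Ioo L.lo L.hi := by
    have h1 : L.lo ≤ a := by
      by_contra! h
      exact hnot L.lo ⟨h, hzI.1.trans hzae.2⟩ hlo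
    have h2 : e ≤ L.hi := by
      by_contra! h
      exact hnot L.hi ⟨hzae.1.trans hzI.2, h⟩ hhi
    exact Ioo_subset_Ioo h1 h2
  have hB : ∀ t ∈ Ioo a e, (t, z.2) ∉ L.noReturn b :=
    fun t ht hn => hnot t ht (Or.inl ⟨_, hn, rfl⟩)
  set N := Fintype.card (Q × Bool × Fin (K + 1))
  have haff : ∀ n ≤ N, ∃ s α : ℝ, (s = 1 ∨ s = -1) ∧ ∀ t ∈ Ioo a e, L.Reg n (t, z.2) ∧
      (∀ i ≤ n, L.cod (t, z.2) i = L.cod z i) ∧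
      (L.T)^[n] (t, z.2) = (s * t + α, ((L.T)^[n] z).2) := fun n hn =>
    affine_of_forall_notMem_noReturn hsub hzae hB fun i h1 h2 => hret i h1 (h2.trans hn)
  set w : ℝ := (a + e) / 2 with hw
  have hwae : w ∈ Ioo a e := ⟨by rw [hw]; linarith, by rw [hw]; linarith⟩
  set p : ℕ → ℝ := fun n => ((L.T)^[n] (w, z.2)).1 with hp
  have hpI : ∀ n ≤ N, L.lo < p n ∧ p n < L.hi := by
    intro n hn
    obtain ⟨s, α, -, h⟩ := haff n hn
    exact mem_Ihat.1 ((h w hwae).1.mem_Ihat (mem_Ihat.2 (hsub hwae)) le_rfl)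
  have hfl : ∀ n ≤ N, ⌊(p n - L.lo) / (δ / 2)⌋₊ < K + 1 := by
    intro n hn
    refine Nat.lt_succ_of_le (Nat.floor_le_floor ?_)
    have := hpI n hn
    gcongr
    exact this.2.le
  let f : Fin (N + 1) → Q × Bool × Fin (K + 1) := fun n =>
    ((L.cod z n)⁻¹ • b, ((L.T)^[n] z).2, ⟨_, hfl n (Nat.lt_succ_iff.1 n.2)⟩)
  obtain ⟨n, m, hnm, hfnm⟩ := Fintype.exists_ne_map_eq_of_card_lt f (by simp [N])
  wlog hlt : n < m generalizing n m
  · exact this m n hnm.symm hfnm.symm (lt_of_le_of_ne (not_lt.1 hlt) hnm.symm)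
  simp only [f, Prod.mk.injEq, Fin.mk.injEq] at hfnm
  obtain ⟨hq, hcomp, hfloor⟩ := hfnm
  have hnN : (n : ℕ) ≤ N := Nat.lt_succ_iff.1 n.2
  have hmN : (m : ℕ) ≤ N := Nat.lt_succ_iff.1 m.2
  have hclose : |p m - p n| < δ / 2 := by
    have h0 : ∀ n ≤ N, 0 ≤ (p n - L.lo) / (δ / 2) := fun n hn =>
      div_nonneg (sub_nonneg.2 (hpI n hn).1.le) (half_pos hδ).le
    have h1 : |(p n - L.lo) / (δ / 2) - (p m - L.lo) / (δ / 2)| < 1 := by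
      have h2 := Nat.floor_le (h0 n hnN)
      have h3 := Nat.floor_le (h0 m hmN)
      have h4 := Nat.lt_floor_add_one ((p n - L.lo) / (δ / 2))
      have h5 := Nat.lt_floor_add_one ((p m - L.lo) / (δ / 2))
      rw [hfloor] at h2 h4
      rw [abs_lt]
      constructor <;> linarith
    rwa [← sub_div, abs_div, abs_of_pos (half_pos hδ), div_lt_one (half_pos hδ),
      sub_sub_sub_cancel_right, abs_sub_comm] at h1
  obtain ⟨s, α, hs, hn⟩ := haff n hnN
  obtain ⟨_, _, -, hm⟩ := haff m hmN
  have hpn : p n = s * w + α := congrArg Prod.fst (hn w hwae).2.2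
  set t : ℝ := w + s * (p m - p n) with ht
  have htae : t ∈ Ioo a e := by
    rw [abs_lt] at hclose
    rcases hs with rfl | rfl
    · constructor <;> rw [ht, hw] <;> linarith
    · constructor <;> rw [ht, hw] <;> linarith
  have hTt : (L.T)^[n] (t, z.2) = (L.T)^[m] (w, z.2) := by
    rw [(hn t htae).2.2]
    refine Prod.ext ?_ ?_
    · change s * t + α = p m
      rw [ht, mul_add, ← mul_assoc, show s * s = 1 by rcases hs with rfl | rfl <;> norm_num]
      linarith
    · rw [(hm w hwae).2.2]
      exact hcomp
  have hlt' : (n : ℕ) < m := hlt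
  obtain ⟨-, hr⟩ := return_of_iterate_eq (b := b) (hn t htae).1 (hm w hwae).1 hlt'.le hTt (by
    rw [(hn t htae).2.1 n le_rfl, (hm w hwae).2.1 m le_rfl, hq])
  rw [(hm w hwae).2.1 _ (Nat.sub_le _ _)] at hr
  exact hret _ (by omega) ((Nat.sub_le _ _).trans hmN) hr

end LinearInvolution

namespace LinearInvolution

variable {A : Type*} [Fintype A] {L : LinearInvolution A} {z : ℝ × Bool} {c d : Letter A}

variable {x y z₀ : ℝ × Bool} {n m N : ℕ} {Q : Type*} [MulAction (FreeGroup A) Q] {b q : Q}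

lemma hit_bound_of_return_bound
    (hN : ∀ z ∈ L.Gen, ∃ n, 1 ≤ n ∧ n ≤ N ∧ (L.cod z n)⁻¹ • b = b) (hz : z ∈ L.Gen)
    (h : ∃ n, (L.cod z n)⁻¹ • q = b) :
    (∃ n ≤ N, (L.cod z n)⁻¹ • q = b) ∧ ∃ n ≤ N, (L.cod (s2 z) n)⁻¹ • q = b := by
  classical
  obtain ⟨n, hn, hmin⟩ : ∃ n, (L.cod z n)⁻¹ • q = b ∧ ∀ i < n, (L.cod z i)⁻¹ • q ≠ b :=
    ⟨Nat.find h, Nat.find_spec h, fun i hi => Nat.find_min h hi⟩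
  obtain ⟨m, hm1, hmN, hm⟩ := hN _ (s2_mem_Gen (iterate_mem_Gen hz n))
  have hnm : n < m := by
    by_contra! hmn
    obtain ⟨k, rfl⟩ : ∃ k, n = k + m := ⟨n - m, by omega⟩
    rw [Nat.add_comm, Function.iterate_add_apply,
      (Gen.reg (iterate_mem_Gen hz k) m).cod_s2, inv_inv] at hm
    refine hmin k (by omega) ?_
    rw [cod_add, mul_inv_rev, mul_smul, inv_smul_eq_iff, hm] at hn
    exact hn
  refine ⟨⟨n, hnm.le.trans hmN, hn⟩, m - n, (Nat.sub_le _ _).trans hmN, ?_⟩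
  obtain ⟨k, rfl⟩ : ∃ k, m = n + k := ⟨m - n, by omega⟩
  rw [cod_add, (Gen.reg hz n).cod_s2, (Gen.reg hz n).s2_iterate, mul_inv_rev, inv_inv, mul_smul,
    ← inv_smul_eq_iff.1 hn] at hm
  rwa [Nat.add_sub_cancel_left]

lemma exists_mem_Gen_Ia (hnc : ¬ L.HasConnection) (c : Letter A) : ∃ z ∈ L.Gen, z ∈ L.Ia c := by
  obtain ⟨t, ht⟩ := exists_between (L.end_lt c)
  have h : (t, L.comp c) ∈ L.Ia c := mem_Ia.2 ⟨ht, rfl⟩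
  obtain ⟨z, hz, hzc, -⟩ := exists_mem_Gen hnc (isOpen_Ia c) (mem_dom h).1 h
  exact ⟨z, hz, hzc⟩

/-- From every generic point, every state is brought to `b` in at most `N` steps. -/
def HitsBy (L : LinearInvolution A) (b : Q) (N : ℕ) : Prop :=
  ∀ z ∈ L.Gen, ∀ q : Q, ∃ n ≤ N, (L.cod z n)⁻¹ • q = b

lemma exists_hitsBy [Finite Q] [MulAction.IsPretransitive (FreeGroup A) Q]
    (hnc : ¬ L.HasConnection) (b : Q) : ∃ N, L.HitsBy b N := by
  obtain ⟨N, hN⟩ := exists_return_bound hnc b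
  refine ⟨N, ?_⟩
  let f : Q → ℝ × Bool → Prop := fun q z => ∃ n ≤ N, (L.cod z n)⁻¹ • q = b
  have hs2 : ∀ q, ∀ z ∈ L.Gen, f q z → f q (s2 z) := fun q z hz ⟨n, _, hn⟩ =>
    (hit_bound_of_return_bound hN hz ⟨n, hn⟩).2
  have hall : ∀ q, ∀ z ∈ L.Gen, f q z → ∀ y ∈ L.Gen, f q y := by
    intro q z hz h y hy
    obtain ⟨v, hv⟩ := const_of_s2_invariant hnc (f := f q)
      (fun z hz => propext ⟨fun h => by simpa using hs2 q _ (s2_mem_Gen hz) h, hs2 q z hz⟩)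
      fun x _ hx => ⟨f q x, by
        filter_upwards [nhdsWithin_le_nhds (hx N).eventually_cod_eq_le] with y hy
        refine propext (exists_congr fun n => and_congr_right fun hn => ?_)
        rw [hy n hn]⟩
    rwa [hv y hy, ← hv z hz]
  have hstep : ∀ (c : Letter A) q, (∀ z ∈ L.Gen, f q z) →
      ∀ z ∈ L.Gen, f ((FreeGroup.mk [c])⁻¹ • q) z := by
    intro c q hq
    obtain ⟨z, hz, hzc⟩ := exists_mem_Gen_Ia hnc c
    obtain ⟨n, -, hn⟩ := hq _ (s2_mem_Gen hz)
    refine hall _ _ (s2_mem_Gen (T_mem_Gen hz))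
      (hit_bound_of_return_bound hN (s2_mem_Gen (T_mem_Gen hz)) ⟨n + 1, ?_⟩).1
    have hd := Gen.mem_dom hz
    rw [s2_T, cod_succ, T_s1 hd, elt_s1 hd, elt_eq hzc, mul_inv_rev, inv_inv, mul_smul,
      smul_inv_smul, hn]
  intro z hz q
  obtain ⟨g, rfl⟩ := MulAction.exists_smul_eq (FreeGroup A) b q
  revert z
  refine freeGroup_induction (p := fun g => ∀ z ∈ L.Gen, f (g • b) z)
    (fun z _ => ⟨0, N.zero_le, by simp⟩) (fun c g ih => ?_) g
  have := hstep (Letter.inv c) _ ih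
  rwa [mk_letter_inv, inv_inv, smul_smul] at this

/-- The number of steps bringing the state `q` to `b` along the orbit of `z`. -/
noncomputable def hitTime (L : LinearInvolution A) (b : Q) (z : ℝ × Bool) (q : Q) : ℕ :=
  sInf {n | (L.cod z n)⁻¹ • q = b}

/-- The group element read until the state `q` is brought to `b`. -/
noncomputable def hitWord (L : LinearInvolution A) (b : Q) (z : ℝ × Bool) (q : Q) : FreeGroup A :=
  L.cod z (L.hitTime b z q)

lemma HitsBy.hitTime_spec (hH : L.HitsBy b N) (hz : z ∈ L.Gen) (q : Q) :
    (L.hitWord b z q)⁻¹ • q = b := by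
  obtain ⟨n, -, hn⟩ := hH z hz q
  exact Nat.sInf_mem (s := {n | (L.cod z n)⁻¹ • q = b}) ⟨n, hn⟩

lemma hitTime_eq (hn : (L.cod z n)⁻¹ • q = b) (h : ∀ i < n, (L.cod z i)⁻¹ • q ≠ b) :
    L.hitTime b z q = n := by
  refine le_antisymm (Nat.sInf_le hn) ?_
  by_contra! hlt
  exact h _ hlt (Nat.sInf_mem (s := {n | (L.cod z n)⁻¹ • q = b}) ⟨n, hn⟩)

lemma not_hit_of_lt (h : n < L.hitTime b z q) : (L.cod z n)⁻¹ • q ≠ b :=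
  Nat.notMem_of_lt_sInf (s := {n | (L.cod z n)⁻¹ • q = b}) h

@[simp]
lemma hitTime_self : L.hitTime b z b = 0 :=
  hitTime_eq (by simp) fun i hi => absurd hi i.not_lt_zero

@[simp]
lemma hitWord_self : L.hitWord b z b = 1 := by
  rw [hitWord, hitTime_self, cod_zero]

lemma HitsBy.hitTime_of_ne (hH : L.HitsBy b N) (hz : z ∈ L.Gen) (hq : q ≠ b) :
    L.hitTime b z q = L.hitTime b (L.T z) ((L.elt z)⁻¹ • q) + 1 := by
  refine hitTime_eq ?_ ?_
  · rw [cod_succ, mul_inv_rev, mul_smul]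
    exact hH.hitTime_spec (T_mem_Gen hz) _
  · rintro (_ | i) hi
    · simpa using hq
    · rw [cod_succ, mul_inv_rev, mul_smul]
      exact not_hit_of_lt (Nat.lt_of_succ_lt_succ hi)

lemma HitsBy.hitWord_of_ne (hH : L.HitsBy b N) (hz : z ∈ L.Gen) (hq : q ≠ b) :
    L.hitWord b z q = L.elt z * L.hitWord b (L.T z) ((L.elt z)⁻¹ • q) := by
  rw [hitWord, hH.hitTime_of_ne hz hq, cod_succ, hitWord]

lemma HitsBy.eq_of_hitTime_eq_zero (hH : L.HitsBy b N) (hz : z ∈ L.Gen)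
    (h : L.hitTime b z q = 0) : q = b := by
  simpa [hitWord, h] using hH.hitTime_spec hz q

/-- The group element read between two consecutive visits to `b`, around the point `z` with
state `q`. -/
noncomputable def retWord (L : LinearInvolution A) (b : Q) (z : ℝ × Bool) (q : Q) : FreeGroup A :=
  (L.hitWord b (s2 z) q)⁻¹ * L.elt z * L.hitWord b (L.T z) ((L.elt z)⁻¹ • q)

lemma retWord_self : L.retWord b z b = L.elt z * L.hitWord b (L.T z) ((L.elt z)⁻¹ • b) := by
  simp [retWord]

lemma retWord_s2_T (hz : z ∈ L.Gen) :
    L.retWord b (s2 (L.T z)) ((L.elt z)⁻¹ • q) = (L.retWord b z q)⁻¹ := by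
  have hd := Gen.mem_dom hz
  rw [retWord, s2_s2, s2_T, T_s1 hd, elt_s1 hd, retWord, inv_inv, smul_inv_smul]
  group

lemma HitsBy.retWord_of_ne (hH : L.HitsBy b N) (hz : z ∈ L.Gen) (hq : q ≠ b) :
    L.retWord b z q = (L.hitWord b (s2 z) q)⁻¹ * L.hitWord b z q := by
  rw [retWord, hH.hitWord_of_ne hz hq, mul_assoc]

lemma HitsBy.retWord_s2 (hH : L.HitsBy b N) (hz : z ∈ L.Gen) (hq : q ≠ b) :
    L.retWord b (s2 z) q = (L.retWord b z q)⁻¹ := by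
  rw [hH.retWord_of_ne hz hq, hH.retWord_of_ne (s2_mem_Gen hz) hq, s2_s2]
  group

lemma HitsBy.retWord_T (hH : L.HitsBy b N) (hz : z ∈ L.Gen) (hq : (L.elt z)⁻¹ • q ≠ b) :
    L.retWord b (L.T z) ((L.elt z)⁻¹ • q) = L.retWord b z q := by
  rw [← inv_inj, ← hH.retWord_s2 (T_mem_Gen hz) hq, retWord_s2_T hz]

/-- The set of first return elements to the stabilizer of `b`. -/
def returns (L : LinearInvolution A) (b : Q) : Set (FreeGroup A) :=
  {g | ∃ z ∈ L.Gen, L.retWord b z b = g}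

lemma HitsBy.retWord_mem (hH : L.HitsBy b N) (hz : z ∈ L.Gen) (q : Q) :
    L.retWord b z q ∈ L.returns b := by
  induction hn : L.hitTime b (s2 z) q generalizing z q with
  | zero => exact ⟨z, hz, by rw [hH.eq_of_hitTime_eq_zero (s2_mem_Gen hz) hn]⟩
  | succ n ih =>
    have hq : q ≠ b := by
      rintro rfl
      simp at hn
    have hz' := s2_mem_Gen hz
    have hd := Gen.mem_dom hz'
    have hz1 := s2_mem_Gen (T_mem_Gen hz')
    rw [hH.hitTime_of_ne hz' hq] at hn
    have h1 := ih hz1 ((L.elt (s2 z))⁻¹ • q) (by rw [s2_s2]; omega)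
    have he : (L.elt (s2 (L.T (s2 z))))⁻¹ • (L.elt (s2 z))⁻¹ • q = q := by
      rw [s2_T, elt_s1 hd, inv_inv, smul_inv_smul]
    have hT : L.T (s2 (L.T (s2 z))) = z := by rw [s2_T, T_s1 hd, s2_s2]
    rwa [← hH.retWord_T hz1 (by rwa [he]), he, hT] at h1

lemma HitsBy.inv_mem_returns (hH : L.HitsBy b N) {g : FreeGroup A} (hg : g ∈ L.returns b) :
    g⁻¹ ∈ L.returns b := by
  obtain ⟨z, hz, rfl⟩ := hg
  rw [← retWord_s2_T hz]
  exact hH.retWord_mem (s2_mem_Gen (T_mem_Gen hz)) _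

/-- The state `q` is brought to `b` along the orbit of `x` before it reaches a division point. -/
def HitsRegularly (L : LinearInvolution A) (b : Q) (x : ℝ × Bool) (q : Q) : Prop :=
  ∃ n, L.Reg n x ∧ (L.cod x n)⁻¹ • q = b

lemma hitsRegularly_self : L.HitsRegularly b x b :=
  ⟨0, fun i hi => absurd hi i.not_lt_zero, by simp⟩

lemma HitsRegularly.eventually_hitWord (h : L.HitsRegularly b x q) :
    ∀ᶠ z in 𝓝 x, L.hitWord b z q = L.hitWord b x q := by
  obtain ⟨n, hn, hq⟩ := h
  have hle : L.hitTime b x q ≤ n := Nat.sInf_le hq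
  filter_upwards [hn.eventually_cod_eq_le] with z hz
  have : L.hitTime b z q = L.hitTime b x q := by
    refine hitTime_eq ?_ fun i hi => ?_
    · rw [hz _ hle]
      exact Nat.sInf_mem (s := {n | (L.cod x n)⁻¹ • q = b}) ⟨n, hq⟩
    · rw [hz _ (hi.le.trans hle)]
      exact not_hit_of_lt hi
  rw [hitWord, this, hz _ hle, hitWord]

lemma HitsBy.hitsRegularly (hH : L.HitsBy b N) (hnc : ¬ L.HasConnection) (hx : x ∈ L.Ihat)
    (h : L.Reg N x) (q : Q) : L.HitsRegularly b x q := by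
  have := nhdsWithin_Gen_neBot hnc hx
  have hev : ∀ᶠ z in 𝓝[L.Gen] x, ∀ i ≤ N, L.cod z i = L.cod x i :=
    nhdsWithin_le_nhds h.eventually_cod_eq_le
  obtain ⟨z, hz, hzg⟩ := (hev.and self_mem_nhdsWithin).exists
  obtain ⟨n, hn, hq⟩ := hH z hzg q
  exact ⟨n, h.mono hn, by rwa [← hz n hn]⟩

end LinearInvolution

namespace LinearInvolution

variable {A : Type*} [Fintype A] {L : LinearInvolution A} {z : ℝ × Bool} {c d : Letter A}

variable {N : ℕ} {Q : Type*} [MulAction (FreeGroup A) Q] {b : Q}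

/-- The first return elements generate the stabilizer of `b`. -/
lemma HitsBy.mem_of_returns_subset (hH : L.HitsBy b N) (hnc : ¬ L.HasConnection)
    (H : Subgroup (FreeGroup A)) (hP : L.returns b ⊆ H) {u : FreeGroup A} (hu : u • b = b) :
    u ∈ H := by
  let κ : Q → ℝ × Bool → FreeGroup A ⧸ H := fun q z => (L.hitWord b z q : FreeGroup A ⧸ H)
  have hconst : ∀ q, ∃ v, ∀ z ∈ L.Gen, κ q z = v := by
    refine fun q => const_of_s2_invariant hnc (fun z hz => ?_) fun x hx hr => ⟨κ q x, ?_⟩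
    · by_cases hq : q = b
      · simp [κ, hq]
      · rw [QuotientGroup.eq, ← hH.retWord_of_ne hz hq]
        exact hP (hH.retWord_mem hz q)
    · filter_upwards [nhdsWithin_le_nhds (hH.hitsRegularly hnc hx (hr N) q).eventually_hitWord]
        with z hz
      simp only [κ, hz]
  choose v hv using hconst
  have hstep : ∀ (c : Letter A) q, v ((FreeGroup.mk [c])⁻¹ • q) = (FreeGroup.mk [c])⁻¹ • v q := by
    intro c q
    obtain ⟨z, hz, hzc⟩ := exists_mem_Gen_Ia hnc c
    rw [← hv _ _ (T_mem_Gen hz), ← hv _ _ hz, ← elt_eq hzc, MulAction.Quotient.smul_coe,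
      QuotientGroup.eq]
    by_cases hq : q = b
    · subst hq
      have h := H.inv_mem (hP (hH.retWord_mem hz q))
      simpa [retWord, mul_assoc] using h
    · rw [hH.hitWord_of_ne hz hq]
      simp
  have hone : v b = ((1 : FreeGroup A) : FreeGroup A ⧸ H) := by
    obtain ⟨z, hz, -⟩ := exists_mem_Gen hnc isOpen_univ
      (mem_Ihat.2 (exists_between L.lo_lt_hi).choose_spec : (_, true) ∈ L.Ihat) trivial
    rw [← hv b z hz]
    simp [κ]
  have hall : v (u • b) = u • v b := by
    refine freeGroup_induction (p := fun g => v (g • b) = g • v b) (by simp) (fun c g ih => ?_) u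
    have := hstep (Letter.inv c) (g • b)
    rw [mk_letter_inv, inv_inv, ih] at this
    rw [mul_smul, this, mul_smul]
  rw [hu, hone, MulAction.Quotient.smul_coe, QuotientGroup.eq] at hall
  simpa using hall

end LinearInvolution

namespace LinearInvolution

variable {A : Type*} [Fintype A] {L : LinearInvolution A} {z : ℝ × Bool} {c d : Letter A}

/-- A function on the line with prescribed jumps at finitely many points. -/
lemma exists_jump {Γ : Type*} [Group Γ] (D : Finset ℝ) (J : ℝ → Γ) (hJ : ∀ t ∉ D, J t = 1) :
    ∃ F : ℝ → Γ, ∀ t, ∀ᶠ s in 𝓝 t, F s = if s ≤ t then F t else F t * J t := by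
  classical
  induction D using Finset.induction_on_max generalizing J with
  | empty => exact ⟨fun _ => 1, fun t => by simp [hJ]⟩
  | insert m D hD ih =>
    obtain ⟨F, hF⟩ := ih (Function.update J m 1) fun t ht => by
      rcases eq_or_ne t m with rfl | h
      · simp
      · rw [Function.update_of_ne h]
        exact hJ t (by simp [h, ht])
    refine ⟨fun s => if s ≤ m then F s else F s * J m, fun t => ?_⟩
    rcases lt_trichotomy t m with h | rfl | h
    · filter_upwards [hF t, Iio_mem_nhds h] with s hs hsm
      rw [if_pos (le_of_lt hsm), if_pos h.le, hs, Function.update_of_ne h.ne]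
    · filter_upwards [hF t] with s hs
      simp only [Function.update_self, mul_one, ite_self] at hs
      simp [hs]
    · have h1 : t ∉ insert m D := by
        rw [Finset.mem_insert, not_or]
        exact ⟨h.ne', fun ht => (hD t ht).not_gt h⟩
      filter_upwards [hF t, Ioi_mem_nhds h] with s hs hsm
      rw [Function.update_of_ne h.ne', hJ t h1, mul_one, ite_self] at hs
      rw [if_neg (not_le.2 hsm), if_neg (not_le.2 h), hs, hJ t h1, mul_one, ite_self]

variable {N : ℕ} {Q : Type*} [MulAction (FreeGroup A) Q] {b q : Q} {Γ : Type*} [Group Γ]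

lemma mem_Gen_of_fst_eq {y : ℝ × Bool} (hz : z ∈ L.Gen) (h : y.1 = z.1) : y ∈ L.Gen := by
  rcases eq_or_ne y.2 z.2 with h2 | h2
  · rwa [show y = z from Prod.ext h h2]
  · rw [show y = s2 z from Prod.ext h (Bool.eq_not_of_ne h2)]
    exact s2_mem_Gen hz

lemma HitsBy.eventually_retWord (hH : L.HitsBy b N) (hq : q ≠ b) {t : ℝ}
    (h1 : L.HitsRegularly b (t, true) q) (h2 : L.HitsRegularly b (t, false) q) :
    ∃ v, ∀ᶠ s in 𝓝 t, (s, true) ∈ L.Gen → L.retWord b (s, true) q = v := by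
  refine ⟨(L.hitWord b (t, false) q)⁻¹ * L.hitWord b (t, true) q, ?_⟩
  have hc : ∀ β, Continuous fun s : ℝ => (s, (β : Bool)) := fun β => by fun_prop
  filter_upwards [(hc true).continuousAt.eventually h1.eventually_hitWord,
    (hc false).continuousAt.eventually h2.eventually_hitWord] with s h1 h2 hs
  rw [hH.retWord_of_ne hs hq, h1]
  simp [s2, h2]

lemma finite_not_reg (hnc : ¬ L.HasConnection) (N : ℕ) :
    {t | t ∈ Ioo L.lo L.hi ∧ ∃ β, ¬ L.Reg N (t, β)}.Finite := by
  have hfin : (⋃ m ∈ Set.Iic N, L.firstSing m).Finite :=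
    (Set.finite_Iic N).biUnion fun m _ => finite_firstSing hnc m
  refine (hfin.image Prod.fst).subset ?_
  rintro t ⟨ht, β, hβ⟩
  simp only [Reg, not_forall] at hβ
  obtain ⟨n, hn, hnd⟩ := hβ
  obtain ⟨m, hm, hms⟩ := exists_firstSing (mem_Ihat.2 ht : (t, β) ∈ L.Ihat) hnd
  exact ⟨(t, β), Set.mem_biUnion (hm.trans hn.le) hms, rfl⟩

lemma HitsBy.exists_potential (hH : L.HitsBy b N) (hnc : ¬ L.HasConnection)
    (x : FreeGroup A → Γ) (hq : q ≠ b) :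
    ∃ F : ℝ → Γ, ∀ t ∈ Ioo L.lo L.hi,
      (L.HitsRegularly b (t, true) q → ∃ v, ∀ᶠ s in 𝓝 t, F s = v) ∧
      (L.HitsRegularly b (t, false) q → ∃ v, ∀ᶠ s in 𝓝 t, (s, true) ∈ L.Gen →
        F s * (x (L.retWord b (s, true) q))⁻¹ = v) := by
  classical
  set D := {t | t ∈ Ioo L.lo L.hi ∧ ∃ β, ¬ L.Reg N (t, β)} with hDdef
  have hD : D.Finite := finite_not_reg hnc N
  have hreg : ∀ t ∈ Ioo L.lo L.hi, t ∉ D → ∀ β, L.HitsRegularly b (t, β) q := by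
    intro t ht htD β
    refine hH.hitsRegularly hnc (mem_Ihat.2 ht : (t, β) ∈ L.Ihat) ?_ q
    by_contra hn
    exact htD ⟨ht, β, hn⟩
  have hside : ∀ a e, Ioo a e ⊆ Ioo L.lo L.hi → (∀ s ∈ Ioo a e, s ∉ D) →
      ∃ v, ∀ s ∈ Ioo a e, (s, true) ∈ L.Gen → L.retWord b (s, true) q = v := by
    intro a e hI hD
    obtain ⟨v, hv⟩ := const_of_locally hnc hI (β := true)
      (f := fun z => L.retWord b (z.1, true) q) fun t ht => by
        obtain ⟨v, hv⟩ := hH.eventually_retWord hq (hreg t (hI ht) (hD t ht) true)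
          (hreg t (hI ht) (hD t ht) false)
        refine ⟨v, eventually_nhdsWithin_iff.2 ?_⟩
        filter_upwards [(continuous_fst.continuousAt (x := (t, true))).eventually hv] with z hz hzg
        exact hz (mem_Gen_of_fst_eq hzg rfl)
    exact ⟨v, fun s hs hg => hv (s, true) hg hs rfl⟩
  have hlr : ∀ t ∈ D, ∃ p : FreeGroup A × FreeGroup A, ∀ᶠ s in 𝓝 t, (s, true) ∈ L.Gen →
      L.retWord b (s, true) q = if s ≤ t then p.1 else p.2 := by
    intro t ht
    have hmem : (D \ {t})ᶜ ∩ Ioo L.lo L.hi ∈ 𝓝 t :=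
      Filter.inter_mem ((hD.subset Set.sdiff_subset).isClosed.isOpen_compl.mem_nhds (by simp))
        (isOpen_Ioo.mem_nhds ht.1)
    obtain ⟨a, e, hte, hsub⟩ := mem_nhds_iff_exists_Ioo_subset.1 hmem
    have hnD : ∀ s ∈ Ioo a e, s ≠ t → s ∉ D := fun s hs hst hsD => (hsub hs).1 ⟨hsD, hst⟩
    obtain ⟨v₁, h₁⟩ := hside a t (fun s hs => (hsub ⟨hs.1, hs.2.trans hte.2⟩).2)
      fun s hs => hnD s ⟨hs.1, hs.2.trans hte.2⟩ hs.2.ne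
    obtain ⟨v₂, h₂⟩ := hside t e (fun s hs => (hsub ⟨hte.1.trans hs.1, hs.2⟩).2)
      fun s hs => hnD s ⟨hte.1.trans hs.1, hs.2⟩ hs.1.ne'
    refine ⟨(v₁, v₂), ?_⟩
    filter_upwards [isOpen_Ioo.mem_nhds hte] with s hs hg
    rcases lt_trichotomy s t with h | rfl | h
    · rw [if_pos h.le, h₁ s ⟨hs.1, h⟩ hg]
    · obtain ⟨-, β, hβ⟩ := ht
      exact absurd (Gen.reg (mem_Gen_of_fst_eq (y := (s, β)) hg rfl) N) hβ
    · rw [if_neg (not_le.2 h), h₂ s ⟨h, hs.2⟩ hg]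
  choose! p hp using hlr
  let J : ℝ → Γ := fun t =>
    if t ∈ D ∧ ¬ L.HitsRegularly b (t, true) q then (x (p t).1)⁻¹ * x (p t).2 else 1
  obtain ⟨F, hF⟩ := exists_jump hD.toFinset J fun t ht => by
    rw [Set.Finite.mem_toFinset] at ht
    simp [J, ht]
  have hFc : ∀ t, J t = 1 → ∀ᶠ s in 𝓝 t, F s = F t := by
    intro t ht
    filter_upwards [hF t] with s hs
    simpa [ht] using hs
  refine ⟨F, fun t ht => ⟨fun h => ⟨F t, hFc t (by simp [J, h])⟩, fun h => ?_⟩⟩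
  by_cases ht' : L.HitsRegularly b (t, true) q
  · obtain ⟨v, hv⟩ := hH.eventually_retWord hq ht' h
    refine ⟨F t * (x v)⁻¹, ?_⟩
    filter_upwards [hv, hFc t (by simp [J, ht'])] with s h1 h2 hs
    rw [h1 hs, h2]
  · have htD : t ∈ D := by
      by_contra hn
      exact ht' (hreg t ht hn true)
    refine ⟨F t * (x (p t).1)⁻¹, ?_⟩
    filter_upwards [hp t htD, hF t] with s h1 h2 hs
    rw [h1 hs, h2]
    split_ifs
    · rfl
    · simp [J, htD, ht', mul_assoc]

lemma HitsBy.exists_weight (hH : L.HitsBy b N) (hnc : ¬ L.HasConnection)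
    (x : FreeGroup A → Γ) (hx : ∀ g, x g⁻¹ = (x g)⁻¹) :
    ∃ ι : ℝ × Bool → Q → Γ, (∀ z, ι z b = 1) ∧
      (∀ z ∈ L.Gen, ∀ q ≠ b, ι (s2 z) q * x (L.retWord b z q) = ι z q) ∧
      ∀ y ∈ L.Ihat, ∀ q, L.HitsRegularly b y q → ∃ v, ∀ᶠ z in 𝓝[L.Gen] y, ι z q = v := by
  classical
  choose! F hF using fun (q : Q) (hq : q ≠ b) => hH.exists_potential hnc x hq
  refine ⟨fun z q => if q = b then 1 else if z.2 then F q z.1 else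
    F q z.1 * (x (L.retWord b (z.1, true) q))⁻¹, by simp, ?_, ?_⟩
  · rintro ⟨s, β⟩ hz q hq
    cases β
    · have : L.retWord b (s, true) q = _ := hH.retWord_s2 hz hq
      simp [hq, s2, this, hx]
    · simp [hq, s2]
  · rintro ⟨t, β⟩ hy q hr
    by_cases hq : q = b
    · exact ⟨1, by simp [hq]⟩
    simp only [hq, if_false]
    have hβ : ∀ᶠ z : ℝ × Bool in 𝓝 (t, β), z.2 = β :=
      continuous_snd.continuousAt.eventually (p := fun γ => γ = β) (by simp)
    have hfst : Tendsto Prod.fst (𝓝 (t, β)) (𝓝 t) := continuous_fst.continuousAt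
    have ht := hF q hq t (mem_Ihat.1 hy)
    cases β
    · obtain ⟨v, hv⟩ := ht.2 hr
      refine ⟨v, eventually_nhdsWithin_iff.2 ?_⟩
      filter_upwards [hβ, hfst.eventually hv] with z h1 h2 hz
      simpa [h1] using h2 (mem_Gen_of_fst_eq hz rfl)
    · obtain ⟨v, hv⟩ := ht.1 hr
      refine ⟨v, nhdsWithin_le_nhds ?_⟩
      filter_upwards [hβ, hfst.eventually hv] with z h1 h2
      simpa [h1] using h2

end LinearInvolution

namespace LinearInvolution

variable {A : Type*} [Fintype A] {L : LinearInvolution A} {z : ℝ × Bool} {c d : Letter A}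

variable {N : ℕ} {Q : Type*} [MulAction (FreeGroup A) Q] {b : Q} {Γ : Type*} [Group Γ]

/-- The cocycle obtained by recording the return words through `x`, up to the coboundary of `ι`. -/
noncomputable def cocycle (L : LinearInvolution A) (b : Q) (x : FreeGroup A → Γ)
    (ι : ℝ × Bool → Q → Γ) (z : ℝ × Bool) (q : Q) : Γ :=
  ι (s2 z) q * x (L.retWord b z q) * (ι (L.T z) ((L.elt z)⁻¹ • q))⁻¹

lemma cocycle_s2_T {x : FreeGroup A → Γ} (hx : ∀ g, x g⁻¹ = (x g)⁻¹) {ι : ℝ × Bool → Q → Γ}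
    (hz : z ∈ L.Gen) (q : Q) :
    L.cocycle b x ι (s2 (L.T z)) ((L.elt z)⁻¹ • q) = (L.cocycle b x ι z q)⁻¹ := by
  have hd := Gen.mem_dom hz
  rw [cocycle, retWord_s2_T hz, s2_s2, s2_T, T_s1 hd, elt_s1 hd, inv_inv, smul_inv_smul, hx,
    cocycle]
  group

lemma HitsBy.exists_cocycle_eq (hH : L.HitsBy b N) (hnc : ¬ L.HasConnection)
    {x : FreeGroup A → Γ} {ι : ℝ × Bool → Q → Γ} (hι1 : ∀ z, ι z b = 1)
    (hι2 : ∀ z ∈ L.Gen, ∀ q ≠ b, ι (s2 z) q * x (L.retWord b z q) = ι z q)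
    (hι3 : ∀ y ∈ L.Ihat, ∀ q, L.HitsRegularly b y q → ∃ v, ∀ᶠ z in 𝓝[L.Gen] y, ι z q = v)
    (q : Q) (c : Letter A) : ∃ v, ∀ z ∈ L.Gen, z ∈ L.Ia c → L.cocycle b x ι z q = v := by
  have hsub : Ioo (L.endLo c) (L.endHi c) ⊆ Ioo L.lo L.hi :=
    Ioo_subset_Ioo (L.sub_lo c) (L.sub_hi c)
  obtain ⟨v, hv⟩ := const_of_locally hnc hsub (β := L.comp c)
    (f := fun z => L.cocycle b x ι z q) fun t ht => by
      set y : ℝ × Bool := (t, L.comp c) with hy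
      have hyc : y ∈ L.Ia c := mem_Ia.2 ⟨ht, rfl⟩
      have hyd : y ∈ L.dom := mem_dom hyc
      have hyI : y ∈ L.Ihat := hyd.1
      set q' := (FreeGroup.mk [c])⁻¹ • q with hq'
      have helt : ∀ᶠ z in 𝓝[L.Gen] y, L.elt z = FreeGroup.mk [c] := by
        filter_upwards [nhdsWithin_le_nhds (eventually_elt_eq hyd)] with z hz
        rw [hz, elt_eq hyc]
      have hT : Tendsto L.T (𝓝[L.Gen] y) (𝓝[L.Gen] (L.T y)) :=
        tendsto_nhdsWithin_iff.2 ⟨(continuousAt_T hyd).mono_left nhdsWithin_le_nhds,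
          eventually_nhdsWithin_of_forall fun z hz => T_mem_Gen hz⟩
      have hs2 : ∀ y, Tendsto s2 (𝓝[L.Gen] y) (𝓝[L.Gen] (s2 y)) := fun y =>
        tendsto_nhdsWithin_iff.2 ⟨continuous_s2.continuousAt.mono_left nhdsWithin_le_nhds,
          eventually_nhdsWithin_of_forall fun z hz => s2_mem_Gen hz⟩
      have hback : L.HitsRegularly b (s2 y) q → L.HitsRegularly b (s2 (L.T y)) q' →
          ∃ v, ∀ᶠ z in 𝓝[L.Gen] y, L.cocycle b x ι z q = v := by
        intro h1 h2
        obtain ⟨v₁, hv₁⟩ := hι3 _ (s2_mem_Ihat.2 hyI) q h1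
        have hv₁ := (hs2 y).eventually hv₁
        by_cases hqb : q' = b
        · refine ⟨v₁ * x ((L.hitWord b (s2 y) q)⁻¹ * FreeGroup.mk [c]), ?_⟩
          filter_upwards [hv₁, helt,
            (hs2 y).eventually (nhdsWithin_le_nhds h1.eventually_hitWord)] with z e1 e2 e3
          rw [cocycle, retWord, e1, e2, e3, ← hq', hqb, hι1, hitWord_self]
          simp
        · obtain ⟨v₂, hv₂⟩ := hι3 _ (s2_mem_Ihat.2 (T_mem_Ihat hyd)) q' h2
          refine ⟨v₁ * v₂⁻¹, ?_⟩
          filter_upwards [hv₁, helt, hT.eventually ((hs2 _).eventually hv₂),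
            self_mem_nhdsWithin] with z e1 e2 e3 hz
          have hne : (L.elt z)⁻¹ • q ≠ b := by rwa [e2]
          rw [cocycle, ← hH.retWord_T hz hne, ← hι2 _ (T_mem_Gen hz) _ hne, e1, e2, ← hq', e3]
          group
      rcases regular_or_regular hnc hyI with hr | hr
      · by_cases hqb : q = b
        · subst hqb
          refine hback hitsRegularly_self ⟨1, ?_, ?_⟩
          · intro i hi
            rw [Nat.lt_one_iff.1 hi, s2_T]
            exact s1_mem_dom hyd
          · rw [cod_succ, cod_zero, mul_one, s2_T, elt_s1 hyd, elt_eq hyc, inv_inv, hq',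
              smul_inv_smul]
        · obtain ⟨v₁, hv₁⟩ := hι3 y hyI q (hH.hitsRegularly hnc hyI (hr N) q)
          obtain ⟨v₂, hv₂⟩ := hι3 _ (T_mem_Ihat hyd) q'
            (hH.hitsRegularly hnc (T_mem_Ihat hyd) (reg_succ.1 (hr (N + 1))).2 q')
          refine ⟨v₁ * v₂⁻¹, ?_⟩
          filter_upwards [hv₁, helt, hT.eventually hv₂, self_mem_nhdsWithin] with z e1 e2 e3 hz
          rw [cocycle, hι2 z hz q hqb, e1, e2, ← hq', e3]
      · refine hback (hH.hitsRegularly hnc (s2_mem_Ihat.2 hyI) (hr N) q)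
          (hH.hitsRegularly hnc (s2_mem_Ihat.2 (T_mem_Ihat hyd)) ?_ q')
        rw [s2_T]
        exact (reg_succ.2 ⟨s1_mem_dom hyd, by rw [T_s1 hyd]; exact hr N⟩).mono N.le_succ
  exact ⟨v, fun z hz hzc => hv z hz (mem_Ia.1 hzc).1 (mem_Ia.1 hzc).2⟩

/-- The free group acts on `Γ × Q` in such a way that every first return element acts on the fibre
over `b` by the right multiplication prescribed by `x`. -/
lemma HitsBy.exists_action (hH : L.HitsBy b N) (hnc : ¬ L.HasConnection)
    (x : FreeGroup A → Γ) (hx : ∀ g, x g⁻¹ = (x g)⁻¹) :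
    ∃ ρ : FreeGroup A →* Equiv.Perm (Γ × Q), ∀ g ∈ L.returns b, ∀ γ : Γ,
      ρ g⁻¹ (γ, b) = (γ * x g, b) := by
  obtain ⟨ι, hι1, hι2, hι3⟩ := hH.exists_weight hnc x hx
  choose φ hφ using hH.exists_cocycle_eq hnc hι1 hι2 hι3
  have hφinv : ∀ q c, φ ((FreeGroup.mk [c])⁻¹ • q) (Letter.inv c) = (φ q c)⁻¹ := by
    intro q c
    obtain ⟨z, hz, hzc⟩ := exists_mem_Gen_Ia hnc c
    rw [← hφ q c z hz hzc, ← cocycle_s2_T hx hz, elt_eq hzc]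
    refine (hφ _ _ _ (s2_mem_Gen (T_mem_Gen hz)) ?_).symm
    rw [s2_T]
    exact s1_mem hzc
  let step : Letter A → Γ × Q → Γ × Q := fun c p =>
    (p.1 * φ p.2 c, (FreeGroup.mk [c])⁻¹ • p.2)
  have hstep : ∀ c p, step (Letter.inv c) (step c p) = p := by
    rintro c ⟨γ, q⟩
    simp only [step, hφinv, mul_inv_cancel_right]
    rw [mk_letter_inv, inv_inv, smul_inv_smul]
  let ρ : FreeGroup A →* Equiv.Perm (Γ × Q) := FreeGroup.lift fun a =>
    ⟨step (a, false), step (a, true), hstep (a, false), hstep (a, true)⟩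
  have hρ : ∀ c p, (ρ (FreeGroup.mk [c]))⁻¹ p = step c p := by
    rintro ⟨a, β⟩ p
    cases β
    · simp only [ρ, FreeGroup.lift_mk, List.map_cons, List.map_nil, cond_false, List.prod_singleton,
        inv_inv]
      rfl
    · simp only [ρ, FreeGroup.lift_mk, List.map_cons, List.map_nil, cond_true, List.prod_singleton]
      rfl
  have hρz : ∀ z ∈ L.Gen, ∀ γ q, (ρ (L.elt z))⁻¹ (γ, q) =
      (γ * L.cocycle b x ι z q, (L.elt z)⁻¹ • q) := by
    intro z hz γ q
    obtain ⟨c, hc⟩ := mem_dom_iff.1 (Gen.mem_dom hz)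
    rw [elt_eq hc, hρ, hφ q c z hz hc]
  have hhit : ∀ n, ∀ z ∈ L.Gen, ∀ q, L.hitTime b z q = n → ∀ γ,
      (ρ (L.hitWord b z q))⁻¹ (γ, q) = (γ * ι z q, b) := by
    intro n
    induction n with
    | zero =>
      intro z hz q hn γ
      rw [hH.eq_of_hitTime_eq_zero hz hn, hitWord_self, map_one, inv_one, hι1, mul_one]
      rfl
    | succ n ih =>
      intro z hz q hn γ
      have hq : q ≠ b := by
        rintro rfl
        simp at hn
      have hn' := hH.hitTime_of_ne hz hq
      rw [hH.hitWord_of_ne hz hq, map_mul, mul_inv_rev, Equiv.Perm.mul_apply, hρz z hz,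
        ih _ (T_mem_Gen hz) _ (by omega), cocycle, hι2 z hz q hq]
      simp [mul_assoc]
  refine ⟨ρ, ?_⟩
  rintro _ ⟨z, hz, rfl⟩ γ
  rw [map_inv, retWord_self, map_mul, mul_inv_rev, Equiv.Perm.mul_apply, hρz z hz,
    hhit _ _ (T_mem_Gen hz) _ rfl, ← retWord_self, cocycle, hι1]
  simp [mul_assoc]

end LinearInvolution

namespace LinearInvolution

variable {A : Type*} [Fintype A] {L : LinearInvolution A} {z : ℝ × Bool} {c d : Letter A}

variable {N : ℕ} {Q : Type*} [MulAction (FreeGroup A) Q] {b : Q}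

lemma HitsBy.smul_of_mem_returns (hH : L.HitsBy b N) {g : FreeGroup A} (hg : g ∈ L.returns b) :
    g • b = b := by
  obtain ⟨z, hz, rfl⟩ := hg
  rw [smul_eq_iff_eq_inv_smul, retWord_self, mul_inv_rev, mul_smul]
  exact (hH.hitTime_spec (T_mem_Gen hz) _).symm

/-- The first return elements form a symmetric basis of the stabilizer of `b`. -/
lemma HitsBy.isSymmetricBasisOf (hH : L.HitsBy b N) (hnc : ¬ L.HasConnection)
    (hne : ∀ g ∈ L.returns b, g⁻¹ ≠ g) :
    IsSymmetricBasisOf (L.returns b) (MulAction.stabilizer (FreeGroup A) b) := by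
  obtain ⟨X, hX, x, hx, hxX⟩ := exists_half (fun g hg => hH.inv_mem_returns hg) hne
  have hXP : X ⊆ L.returns b := hX ▸ Set.subset_union_left
  refine ⟨X, ⟨?_, le_antisymm ?_ ?_⟩, hX⟩
  · obtain ⟨ρ, hρ⟩ := hH.exists_action hnc x hx
    have key : ∀ v : FreeGroup X, ∀ γ : FreeGroup X,
        ρ (FreeGroup.lift (fun x : X => (x : FreeGroup A)) v)⁻¹ (γ, b) = (γ * v, b) := by
      intro v
      induction v using FreeGroup.induction_on with
      | C1 => simp
      | of g =>
        intro γ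
        rw [FreeGroup.lift_apply_of, hρ _ (hXP g.2), hxX]
      | inv_of g =>
        intro γ
        rw [map_inv (FreeGroup.lift fun x : X => (x : FreeGroup A)), FreeGroup.lift_apply_of,
          hρ _ (hH.inv_mem_returns (hXP g.2)), hx, hxX]
      | mul v w hv hw =>
        intro γ
        rw [map_mul, mul_inv_rev, map_mul, Equiv.Perm.mul_apply, hv, hw, mul_assoc]
    rw [injective_iff_map_eq_one]
    intro v hv
    have := key v 1
    rw [hv] at this
    simpa using this.symm
  · rw [FreeGroup.range_lift_eq_closure, Subgroup.closure_le]
    rintro _ ⟨g, rfl⟩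
    exact hH.smul_of_mem_returns (hXP g.2)
  · intro u hu
    refine hH.mem_of_returns_subset hnc _ ?_ hu
    have hr : ∀ g ∈ X,
        g ∈ (FreeGroup.lift (fun x : X => (x : FreeGroup A)) : FreeGroup X →* FreeGroup A).range :=
      fun g hg => ⟨FreeGroup.of ⟨g, hg⟩, by simp⟩
    rw [hX]
    rintro g (hg | hg)
    · exact hr g hg
    · exact inv_inv g ▸ Subgroup.inv_mem _ (hr _ hg)

variable {m n : ℕ} {u : List (Letter A)}

lemma mk_eq_cod (h : L.IsCodingFrom z m u) : FreeGroup.mk u = L.cod ((L.T)^[m] z) u.length := by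
  induction u generalizing m with
  | nil => rfl
  | cons c u ih =>
    have h0 : (L.T)^[m] z ∈ L.Ia c := h ⟨0, by simp⟩
    have h1 : L.IsCodingFrom z (m + 1) u := by
      intro i
      have := h i.succ
      simpa [Nat.add_assoc, Nat.add_comm 1] using this
    rw [List.length_cons, cod_succ, ← Function.iterate_succ_apply' L.T, ← ih h1, elt_eq h0,
      FreeGroup.mul_mk]
    rfl

lemma IsCodingFrom.of_initial {p : List (Letter A)} (h : L.IsCodingFrom z m u) (hp : p <+: u) :
    L.IsCodingFrom z m p := by
  obtain ⟨s, rfl⟩ := hp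
  intro i
  have := h ⟨i, by rw [List.length_append]; omega⟩
  simpa [List.getElem_append_left i.2] using this

lemma exists_isCodingFrom (hz : z ∈ L.Gen) (n : ℕ) : ∃ u, u.length = n ∧ L.IsCodingFrom z 0 u := by
  choose f hf using fun n => mem_dom_iff.1 (Gen.mem_dom (iterate_mem_Gen hz n))
  refine ⟨List.ofFn fun i : Fin n => f i, by simp, fun i => ?_⟩
  simpa using hf i

lemma IsCodingFrom.isReduced (h : L.IsCodingFrom z m u) : FreeGroup.IsReduced u := by
  rw [FreeGroup.IsReduced, List.isChain_iff_getElem]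
  intro i hi h1
  by_contra h2
  have hc : (L.T)^[m + i] z ∈ L.Ia u[i] := h ⟨i, by omega⟩
  have hd : (L.T)^[m + (i + 1)] z ∈ L.Ia u[i + 1] := h ⟨i + 1, hi⟩
  have he : u[i + 1] = Letter.inv u[i] := Prod.ext h1.symm (Bool.eq_not_of_ne fun h => h2 h.symm)
  have h3 := (mem_Ia.1 (s1_mem hc)).2
  rw [← add_assoc, Function.iterate_succ_apply', he] at hd
  rw [← s2_T, s2, (mem_Ia.1 hd).2] at h3
  simp at h3

lemma mem_lang (hz : z ∈ L.Gen) (h : L.IsCodingFrom z m u) : u ∈ L.lang := ⟨z, hz, m, h⟩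

lemma isCodingFrom_iterate (h : L.IsCodingFrom z m u) : L.IsCodingFrom ((L.T)^[m] z) 0 u := by
  intro i
  rw [zero_add, ← Function.iterate_add_apply, Nat.add_comm]
  exact h i

/-- The prime words code the first returns to the base point. -/
lemma HitsBy.mk_image_primeWords {G : Subgroup (FreeGroup A)} (hb : G = MulAction.stabilizer _ b)
    (hH : L.HitsBy b N) : FreeGroup.mk '' PrimeWords L.lang G = L.returns b := by
  have hG : ∀ g, g ∈ G ↔ g⁻¹ • b = b := by
    intro g
    rw [hb, ← inv_mem_iff]
    rfl
  have hret : ∀ (z : ℝ × Bool) n, (L.cod z (n + 1))⁻¹ • b =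
      (L.cod (L.T z) n)⁻¹ • (L.elt z)⁻¹ • b := by
    intro z n
    rw [cod_succ, mul_inv_rev, mul_smul]
  ext g
  constructor
  · rintro ⟨u, ⟨⟨z, hz, m, hu⟩, h0, hmem, hpre⟩, rfl⟩
    have hy := iterate_mem_Gen hz m
    have hu := isCodingFrom_iterate hu
    set y := (L.T)^[m] z
    obtain ⟨n, hn⟩ : ∃ n, u.length = n + 1 :=
      ⟨u.length - 1, by have := List.length_pos_iff.2 h0; omega⟩
    have hmk := mk_eq_cod hu
    rw [hn, Function.iterate_zero_apply] at hmk
    refine ⟨y, hy, ?_⟩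
    have htime : L.hitTime b (L.T y) ((L.elt y)⁻¹ • b) = n := by
      refine hitTime_eq ?_ fun i hi => ?_
      · rwa [← hret, ← hG, ← hmk]
      · have hp : u.take (i + 1) <+: u := ⟨_, List.take_append_drop _ _⟩
        have hlen : (u.take (i + 1)).length = i + 1 := by rw [List.length_take]; omega
        have hc := IsCodingFrom.of_initial hu hp
        have hmk' := mk_eq_cod hc
        rw [hlen, Function.iterate_zero_apply] at hmk'
        rw [← hret, ne_eq, ← hG, ← hmk']
        refine fun hm => hpre _ hp ?_ ?_ ⟨mem_lang hy hc, hm⟩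
        · rw [← List.length_pos_iff]
          omega
        · intro he
          rw [he] at hlen
          omega
    rw [retWord_self, hitWord, htime, ← cod_succ, hmk]
  · rintro ⟨z, hz, rfl⟩
    set n := L.hitTime b (L.T z) ((L.elt z)⁻¹ • b) with hn
    obtain ⟨u, hlen, hu⟩ := exists_isCodingFrom hz (n + 1)
    have hmk := mk_eq_cod hu
    rw [hlen, Function.iterate_zero_apply] at hmk
    refine ⟨u, ⟨mem_lang hz hu, ?_, ?_, ?_⟩, ?_⟩
    · rintro rfl
      simp at hlen
    · rw [hG, hmk, hret]
      exact hH.hitTime_spec (T_mem_Gen hz) _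
    · rintro p hp h0 hpu ⟨-, hpG⟩
      have hmk' := mk_eq_cod (IsCodingFrom.of_initial hu hp)
      obtain ⟨i, hi⟩ : ∃ i, p.length = i + 1 :=
        ⟨p.length - 1, by have := List.length_pos_iff.2 h0; omega⟩
      have hlt : p.length ≠ u.length := fun h => hpu (hp.eq_of_length h)
      have hle := hp.length_le
      rw [hG, hmk', hi, Function.iterate_zero_apply, hret] at hpG
      exact not_hit_of_lt (by omega) hpG
    · rw [retWord_self, hitWord, ← cod_succ, hmk]

lemma inv_ne_of_mem_primeWords {G : Subgroup (FreeGroup A)} (hu : u ∈ PrimeWords L.lang G) :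
    (FreeGroup.mk u)⁻¹ ≠ FreeGroup.mk u := by
  obtain ⟨⟨z, -, m, h⟩, h0, -⟩ := hu
  exact inv_ne_of_isReduced (IsCodingFrom.isReduced h) h0

end LinearInvolution

end

/-- for any finite-index subgroup `G` of `F_A`, the set of prime
words in `L(T)` with respect to `G` is a symmetric basis of `G`. -/
theorem stmt_9 {A : Type*} [Fintype A] (L : LinearInvolution A)
    (hnc : ¬ L.HasConnection) (G : Subgroup (FreeGroup A))
    (hG : G.FiniteIndex) :
    IsSymmetricBasisOf (FreeGroup.mk '' PrimeWords L.lang G) G := by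
  have := hG
  have hb : G = MulAction.stabilizer (FreeGroup A) ((1 : FreeGroup A) : FreeGroup A ⧸ G) :=
    (MulAction.stabilizer_quotient G).symm
  obtain ⟨N, hH⟩ := LinearInvolution.exists_hitsBy hnc ((1 : FreeGroup A) : FreeGroup A ⧸ G)
  have himg := hH.mk_image_primeWords hb
  have h := hH.isSymmetricBasisOf hnc fun g hg => by
    obtain ⟨u, hu, rfl⟩ := himg.symm ▸ hg
    exact LinearInvolution.inv_ne_of_mem_primeWords hu
  rwa [← himg, MulAction.stabilizer_quotient] at h

end LinInv
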